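/- For every α ∈ ℂ with −Q/2 < Im α < 0 and every y ∈ ℝ, the Fourier transform formula ∫_ℝ exp(2πixy)·D_α(x) dx = w_b(2α + iQ/2)·D_{−iQ/2 − α}(y) holds, the integral converging absolutely (since |D_α(x)| decays exponentially as x → ±∞). -/

import Mathlib

open MeasureTheory

/-- The non-compact quantum dilogarithm `w_b`. -/
noncomputable def wb (b ε : ℝ) (z : ℂ) : ℂ :=
  Complex.exp (Complex.I * ((Real.pi : ℝ) : ℂ) / 2 * z ^ 2 +
    Complex.I * ((Real.pi : ℝ) : ℂ) / 24 * ((b : ℂ) ^ 2 + ((b : ℂ))⁻¹ ^ 2) -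
    ∫ t : ℝ,
      Complex.exp (-(2 * Complex.I * ((t : ℂ) + Complex.I * (ε : ℂ)) * z)) /
        (4 * ((t : ℂ) + Complex.I * (ε : ℂ)) *
          Complex.sinh ((b : ℂ) * ((t : ℂ) + Complex.I * (ε : ℂ))) *
          Complex.sinh (((t : ℂ) + Complex.I * (ε : ℂ)) / (b : ℂ))))

/-- The function `D_α`. -/
noncomputable def Dfun (b ε : ℝ) (α z : ℂ) : ℂ :=
  Complex.exp (Complex.I *
    ∫ t : ℝ,
      Complex.cos (2 * ((t : ℂ) + Complex.I * (ε : ℂ)) * z) *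
          Complex.sin (2 * α * ((t : ℂ) + Complex.I * (ε : ℂ))) /
        (2 * ((t : ℂ) + Complex.I * (ε : ℂ)) *
          Complex.sinh ((b : ℂ) * ((t : ℂ) + Complex.I * (ε : ℂ))) *
          Complex.sinh (((t : ℂ) + Complex.I * (ε : ℂ)) / (b : ℂ))))


namespace QD
open Filter Topology Set

lemma integrable_exp_neg_abs {δ : ℝ} (hδ : 0 < δ) :
    Integrable (fun x : ℝ => Real.exp (-(δ * |x|))) := by
  have h1 : IntegrableOn (fun x : ℝ => Real.exp (-(δ * x))) (Ioi 0) := by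
    simpa [neg_mul] using exp_neg_integrableOn_Ioi 0 hδ
  rw [← integrableOn_univ, ← Iic_union_Ioi (a := (0 : ℝ))]
  refine IntegrableOn.union ?_ ?_
  · refine (integrableOn_exp_mul_Iic hδ 0).congr_fun (fun x hx => ?_) measurableSet_Iic
    simp only [abs_of_nonpos (mem_Iic.1 hx)]
    ring_nf
  · refine h1.congr_fun (fun x hx => ?_) measurableSet_Ioi
    simp only [abs_of_pos (mem_Ioi.1 hx)]

lemma integrable_of_exp_bound {f : ℝ → ℂ} (hf : Continuous f) {C δ : ℝ} (hδ : 0 < δ)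
    (hb : ∀ x, ‖f x‖ ≤ C * Real.exp (-(δ * |x|))) : Integrable f :=
  ((integrable_exp_neg_abs hδ).const_mul C).mono' hf.aestronglyMeasurable
    (Eventually.of_forall hb)

/-- for continuous `f`, an exponential bound for large `|x|` gives integrability -/
lemma integrable_of_exp_bound' {f : ℝ → ℂ} (hf : Continuous f) {C δ T : ℝ} (hδ : 0 < δ)
    (hb : ∀ x, T ≤ |x| → ‖f x‖ ≤ C * Real.exp (-(δ * |x|))) : Integrable f := by
  obtain ⟨M, hM⟩ := (isCompact_Icc (a := -T) (b := T)).exists_bound_of_continuousOn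
    hf.continuousOn
  refine integrable_of_exp_bound hf (C := |C| + |M| * Real.exp (δ * |T|)) hδ ?_
  intro x
  rcases le_or_gt T |x| with h | h
  · refine (hb x h).trans ?_
    gcongr
    have : 0 ≤ |M| * Real.exp (δ * |T|) := by positivity
    linarith [le_abs_self C]
  · have h1 := hM x ⟨by linarith [neg_abs_le x], by linarith [le_abs_self x]⟩
    have h2 : |M| ≤ |M| * (Real.exp (δ * |T|) * Real.exp (-(δ * |x|))) := by
      rw [← Real.exp_add]
      apply le_mul_of_one_le_right (abs_nonneg _)
      apply Real.one_le_exp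
      have : |x| ≤ |T| := h.le.trans (le_abs_self T)
      nlinarith
    have h3 : 0 ≤ |C| * Real.exp (-(δ * |x|)) := by positivity
    calc ‖f x‖ ≤ |M| := h1.trans (le_abs_self M)
      _ ≤ _ := by linarith [mul_assoc |M| (Real.exp (δ * |T|)) (Real.exp (-(δ * |x|))),
                    add_mul |C| (|M| * Real.exp (δ * |T|)) (Real.exp (-(δ * |x|)))]

/-- Holomorphic dependence of parametric integrals. -/
lemma hasDerivAt_param {f : ℂ → ℝ → ℂ} {z₀ : ℂ} {r : ℝ} (hr : 0 < r) {g : ℝ → ℝ}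
    (hg : Integrable g)
    (hm : ∀ z ∈ Metric.ball z₀ r, AEStronglyMeasurable (f z) volume)
    (hd : ∀ x, DifferentiableOn ℂ (fun z => f z x) (Metric.ball z₀ r))
    (hb : ∀ z ∈ Metric.ball z₀ r, ∀ x, ‖f z x‖ ≤ g x) :
    HasDerivAt (fun z => ∫ x, f z x) (∫ x, deriv (fun z => f z x) z₀) z₀ := by
  have h0 : z₀ ∈ Metric.ball z₀ r := Metric.mem_ball_self hr
  have hda : ∀ z ∈ Metric.ball z₀ r, ∀ x, HasDerivAt (fun z => f z x)
      (deriv (fun z => f z x) z) z := fun z hz x =>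
    ((hd x).differentiableAt (Metric.isOpen_ball.mem_nhds hz)).hasDerivAt
  have hs : Metric.ball z₀ (r / 2) ⊆ Metric.ball z₀ r := Metric.ball_subset_ball (by linarith)
  refine (hasDerivAt_integral_of_dominated_loc_of_deriv_le (s := Metric.ball z₀ (r / 2))
    (bound := fun x => g x / (r / 4)) (F' := fun z x => deriv (fun z => f z x) z)
    (Metric.ball_mem_nhds _ (by linarith)) ?_ ?_ ?_ ?_ ?_ ?_).2
  · filter_upwards [Metric.ball_mem_nhds z₀ hr] with z hz using hm z hz
  · exact hg.mono' (hm _ h0) (Eventually.of_forall (hb _ h0))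
  · let u : ℕ → ℂ := fun n => ((r / 2 / ((n : ℝ) + 1) : ℝ) : ℂ)
    have hu0 : ∀ n, u n ≠ 0 := fun n => by
      simp only [u]; exact_mod_cast (by positivity)
    have hu : ∀ n, z₀ + u n ∈ Metric.ball z₀ r := fun n => by
      rw [Metric.mem_ball, dist_eq_norm, add_sub_cancel_left, Complex.norm_real,
        Real.norm_of_nonneg (by positivity)]
      calc r / 2 / ((n : ℝ) + 1) ≤ r / 2 := div_le_self (by linarith) (by linarith [n.cast_nonneg (α := ℝ)])
        _ < r := by linarith
    have hut : Tendsto u atTop (𝓝[≠] 0) := by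
      refine tendsto_nhdsWithin_iff.2 ⟨?_, Eventually.of_forall hu0⟩
      have : Tendsto (fun n : ℕ => r / 2 / ((n : ℝ) + 1)) atTop (𝓝 0) :=
        by
        have := (tendsto_const_div_atTop_nhds_zero_nat (r / 2)).comp (tendsto_add_atTop_nat 1)
        refine this.congr fun n => ?_
        simp
      exact (Complex.continuous_ofReal.tendsto' 0 0 (by simp)).comp this
    refine aestronglyMeasurable_of_tendsto_ae atTop
      (f := fun n x => (u n)⁻¹ • (f (z₀ + u n) x - f z₀ x)) ?_ ?_
    · intro n
      exact ((hm _ (hu n)).sub (hm _ h0)).const_smul (u n)⁻¹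
    · refine Eventually.of_forall fun x => ?_
      exact (hasDerivAt_iff_tendsto_slope_zero.1 (hda z₀ h0 x)).comp hut
  · refine Eventually.of_forall fun x z hz => ?_
    refine Complex.norm_deriv_le_of_forall_mem_sphere_norm_le (by linarith) ?_ ?_
    · refine (hd x).diffContOnCl_ball ?_
      intro w hw
      rw [Metric.mem_closedBall] at hw
      rw [Metric.mem_ball] at *
      linarith [dist_triangle w z z₀]
    · intro w hw
      refine hb _ ?_ _
      rw [Metric.mem_ball] at *
      rw [Metric.mem_sphere] at hw
      linarith [dist_triangle w z z₀]
  · exact hg.div_const _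
  · exact Eventually.of_forall fun x z hz => hda z (hs hz) x

end QD

open MeasureTheory

namespace QD
open Filter Topology Set

lemma line_ne {v : ℝ} (hv : v ≠ 0) (x : ℝ) : (x : ℂ) + Complex.I * (v : ℂ) ≠ 0 := by
  intro h
  apply hv
  simpa using congrArg Complex.im h

lemma norm_line_ge (x v : ℝ) : |x| ≤ ‖(x : ℂ) + Complex.I * (v : ℂ)‖ := by
  simpa using Complex.abs_re_le_norm ((x : ℂ) + Complex.I * (v : ℂ))

lemma tendsto_inv_line (v : ℝ) :
    Tendsto (fun T : ℝ => ((T : ℂ) + Complex.I * (v : ℂ))⁻¹) atTop (𝓝 0) := by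
  apply squeeze_zero_norm' _ tendsto_inv_atTop_zero
  filter_upwards [eventually_gt_atTop 0] with T hT
  rw [norm_inv]
  have := norm_line_ge T v
  rw [abs_of_pos hT] at this
  gcongr

lemma tendsto_inv_line_neg (v : ℝ) :
    Tendsto (fun T : ℝ => (((-T : ℝ) : ℂ) + Complex.I * (v : ℂ))⁻¹) atTop (𝓝 0) := by
  apply squeeze_zero_norm' _ tendsto_inv_atTop_zero
  filter_upwards [eventually_gt_atTop 0] with T hT
  rw [norm_inv]
  have := norm_line_ge (-T) v
  rw [abs_neg, abs_of_pos hT] at this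
  gcongr

lemma cont_line (v : ℝ) : Continuous fun x : ℝ => (x : ℂ) + Complex.I * (v : ℂ) := by fun_prop

lemma hasDerivAt_line (v x : ℝ) :
    HasDerivAt (fun x : ℝ => (x : ℂ) + Complex.I * (v : ℂ)) 1 x := by
  simpa using (Complex.ofRealCLM.hasDerivAt (x := x)).add_const (Complex.I * (v : ℂ))

lemma pole2 {v : ℝ} (hv : v ≠ 0) :
    Tendsto (fun T : ℝ => ∫ x in (-T)..T, 1 / ((x : ℂ) + Complex.I * (v : ℂ)) ^ 2)
      atTop (𝓝 0) := by
  have : ∀ T : ℝ, ∫ x in (-T)..T, 1 / ((x : ℂ) + Complex.I * (v : ℂ)) ^ 2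
      = -((T : ℂ) + Complex.I * (v : ℂ))⁻¹ - -(((-T : ℝ) : ℂ) + Complex.I * (v : ℂ))⁻¹ := by
    intro T
    refine intervalIntegral.integral_eq_sub_of_hasDerivAt
      (f := fun x : ℝ => -((x : ℂ) + Complex.I * (v : ℂ))⁻¹) (fun x _ => ?_) ?_
    · refine ((hasDerivAt_line v x).inv (line_ne hv x)).neg.congr_deriv ?_
      ring
    · apply Continuous.intervalIntegrable
      exact continuous_const.div ((cont_line v).pow 2) fun x => pow_ne_zero _ (line_ne hv x)
  simp_rw [this]
  simpa using (tendsto_inv_line v).neg.sub (tendsto_inv_line_neg v).neg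

lemma pole3 {v : ℝ} (hv : v ≠ 0) :
    Tendsto (fun T : ℝ => ∫ x in (-T)..T, 1 / ((x : ℂ) + Complex.I * (v : ℂ)) ^ 3)
      atTop (𝓝 0) := by
  have : ∀ T : ℝ, ∫ x in (-T)..T, 1 / ((x : ℂ) + Complex.I * (v : ℂ)) ^ 3
      = -(1 / 2) * (((T : ℂ) + Complex.I * (v : ℂ))⁻¹) ^ 2
        - -(1 / 2) * ((((-T : ℝ) : ℂ) + Complex.I * (v : ℂ))⁻¹) ^ 2 := by
    intro T
    refine intervalIntegral.integral_eq_sub_of_hasDerivAt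
      (f := fun x : ℝ => -(1 / 2) * (((x : ℂ) + Complex.I * (v : ℂ))⁻¹) ^ 2) (fun x _ => ?_) ?_
    · refine ((((hasDerivAt_line v x).inv (line_ne hv x)).pow 2).const_mul (-(1 / 2) : ℂ)).congr_deriv ?_
      have := line_ne hv x
      simp
      field_simp
    · apply Continuous.intervalIntegrable
      exact continuous_const.div ((cont_line v).pow 3) fun x => pow_ne_zero _ (line_ne hv x)
  simp_rw [this]
  simpa using (((tendsto_inv_line v).pow 2).const_mul (-(1 / 2) : ℂ)).sub
    (((tendsto_inv_line_neg v).pow 2).const_mul (-(1 / 2) : ℂ))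

lemma pole1_eq {v : ℝ} (hv : v ≠ 0) (T : ℝ) :
    ∫ x in (-T)..T, 1 / ((x : ℂ) + Complex.I * (v : ℂ))
      = -(2 * Complex.I * (Real.arctan (T / v) : ℝ)) := by
  have h : ∫ x in (-T)..T, 1 / ((x : ℂ) + Complex.I * (v : ℂ))
      = (((1 / 2 * Real.log (T ^ 2 + v ^ 2) : ℝ) : ℂ)
          - Complex.I * (Real.arctan (T / v) : ℝ))
        - (((1 / 2 * Real.log ((-T) ^ 2 + v ^ 2) : ℝ) : ℂ)
          - Complex.I * (Real.arctan ((-T) / v) : ℝ)) := by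
    refine intervalIntegral.integral_eq_sub_of_hasDerivAt
      (f := fun x : ℝ => (((1 / 2 * Real.log (x ^ 2 + v ^ 2) : ℝ) : ℂ)
          - Complex.I * (Real.arctan (x / v) : ℝ))) (fun x _ => ?_) ?_
    · have hp : x ^ 2 + v ^ 2 ≠ 0 := by positivity
      have h1 : HasDerivAt (fun x : ℝ => 1 / 2 * Real.log (x ^ 2 + v ^ 2))
          (x / (x ^ 2 + v ^ 2)) x := by
        refine (((((hasDerivAt_id x).pow 2).add_const (v ^ 2)).log hp).const_mul (1 / 2 : ℝ)).congr_deriv ?_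
        simp
        field_simp
      have h2 : HasDerivAt (fun x : ℝ => Real.arctan (x / v)) (v / (x ^ 2 + v ^ 2)) x := by
        refine ((hasDerivAt_id x).div_const v).arctan.congr_deriv ?_
        simp only [id]
        have : 1 + (x / v) ^ 2 ≠ 0 := by positivity
        field_simp
        ring
      refine (h1.ofReal_comp.sub (h2.ofReal_comp.const_mul Complex.I)).congr_deriv ?_
      have h3 := line_ne hv x
      have h4 : ((x : ℂ) ^ 2 + (v : ℂ) ^ 2) ≠ 0 := by exact_mod_cast hp
      push_cast
      rw [mul_div_assoc', ← sub_div, div_eq_div_iff h4 h3]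
      linear_combination -(v : ℂ) ^ 2 * Complex.I_sq
    · apply Continuous.intervalIntegrable
      exact continuous_const.div (cont_line v) fun x => (line_ne hv x)
  rw [h, neg_div, Real.arctan_neg]
  push_cast
  ring_nf

lemma pole1_pos {v : ℝ} (hv : 0 < v) :
    Tendsto (fun T : ℝ => ∫ x in (-T)..T, 1 / ((x : ℂ) + Complex.I * (v : ℂ)))
      atTop (𝓝 (-(Complex.I * Real.pi))) := by
  simp_rw [pole1_eq hv.ne']
  have h1 : Tendsto (fun T : ℝ => Real.arctan (T / v)) atTop (𝓝 (Real.pi / 2)) :=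
    (Real.tendsto_arctan_atTop.mono_right nhdsWithin_le_nhds).comp
      (tendsto_id.atTop_div_const hv)
  have h2 := ((Complex.continuous_ofReal.tendsto _).comp h1).const_mul (2 * Complex.I)
  refine (h2.neg.congr fun T => rfl).mono_right (le_of_eq ?_)
  push_cast
  ring_nf

lemma pole1_neg {v : ℝ} (hv : v < 0) :
    Tendsto (fun T : ℝ => ∫ x in (-T)..T, 1 / ((x : ℂ) + Complex.I * (v : ℂ)))
      atTop (𝓝 (Complex.I * Real.pi)) := by
  simp_rw [pole1_eq hv.ne]
  have h1 : Tendsto (fun T : ℝ => Real.arctan (T / v)) atTop (𝓝 (-(Real.pi / 2))) :=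
    (Real.tendsto_arctan_atBot.mono_right nhdsWithin_le_nhds).comp
      (tendsto_id.atTop_div_const_of_neg hv)
  have h2 := ((Complex.continuous_ofReal.tendsto _).comp h1).const_mul (2 * Complex.I)
  refine (h2.neg.congr fun T => rfl).mono_right (le_of_eq ?_)
  push_cast
  ring_nf

lemma poles_lim {v : ℝ} (hv : v ≠ 0) (A B C L : ℂ)
    (hL : Tendsto (fun T : ℝ => ∫ x in (-T)..T, 1 / ((x : ℂ) + Complex.I * (v : ℂ)))
      atTop (𝓝 L)) :
    Tendsto (fun T : ℝ => ∫ x in (-T)..T, (A / ((x : ℂ) + Complex.I * (v : ℂ)) ^ 3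
      + B / ((x : ℂ) + Complex.I * (v : ℂ)) ^ 2 + C / ((x : ℂ) + Complex.I * (v : ℂ))))
      atTop (𝓝 (C * L)) := by
  have h := (((pole3 hv).const_mul A).add ((pole2 hv).const_mul B)).add (hL.const_mul C)
  simp only [mul_zero, zero_add] at h
  refine h.congr fun T => ?_
  have i3 : IntervalIntegrable (fun x : ℝ => A * (1 / ((x : ℂ) + Complex.I * (v : ℂ)) ^ 3))
      volume (-T) T := (continuous_const.mul (continuous_const.div ((cont_line v).pow 3)
        fun x => pow_ne_zero _ (line_ne hv x))).intervalIntegrable _ _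
  have i2 : IntervalIntegrable (fun x : ℝ => B * (1 / ((x : ℂ) + Complex.I * (v : ℂ)) ^ 2))
      volume (-T) T := (continuous_const.mul (continuous_const.div ((cont_line v).pow 2)
        fun x => pow_ne_zero _ (line_ne hv x))).intervalIntegrable _ _
  have i1 : IntervalIntegrable (fun x : ℝ => C * (1 / ((x : ℂ) + Complex.I * (v : ℂ))))
      volume (-T) T := (continuous_const.mul (continuous_const.div (cont_line v)
        fun x => line_ne hv x)).intervalIntegrable _ _
  rw [← intervalIntegral.integral_const_mul, ← intervalIntegral.integral_const_mul,
    ← intervalIntegral.integral_const_mul, ← intervalIntegral.integral_add i3 i2,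
    ← intervalIntegral.integral_add (i3.add i2) i1]
  simp only [mul_one_div]

end QD

open MeasureTheory

namespace QD
open Filter Topology Set

lemma contour_shift {f g : ℂ → ℂ} {A B C : ℂ} {c d : ℝ} (hc : c < 0) (hd : 0 < d)
    (hg : ∀ t : ℂ, c ≤ t.im → t.im ≤ d → DifferentiableAt ℂ g t)
    (hfg : ∀ t : ℂ, t ≠ 0 → c ≤ t.im → t.im ≤ d → f t = A / t ^ 3 + B / t ^ 2 + C / t + g t)
    {K δ T : ℝ} (hδ : 0 < δ)
    (hb : ∀ t : ℂ, c ≤ t.im → t.im ≤ d → T ≤ |t.re| → ‖f t‖ ≤ K * Real.exp (-(δ * |t.re|))) :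
    Integrable (fun x : ℝ => f ((x : ℂ) + Complex.I * (c : ℂ))) ∧
    Integrable (fun x : ℝ => f ((x : ℂ) + Complex.I * (d : ℂ))) ∧
    (∫ x : ℝ, f ((x : ℂ) + Complex.I * (c : ℂ))) - (∫ x : ℝ, f ((x : ℂ) + Complex.I * (d : ℂ)))
      = 2 * Real.pi * Complex.I * C := by
  have hgc : ∀ v : ℝ, c ≤ v → v ≤ d →
      Continuous fun x : ℝ => g ((x : ℂ) + Complex.I * (v : ℂ)) := by
    intro v h1 h2
    rw [continuous_iff_continuousAt]
    intro x
    have := (hg ((x : ℂ) + Complex.I * (v : ℂ)) (by simpa) (by simpa)).continuousAt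
    exact ContinuousAt.comp (f := fun x : ℝ => (x : ℂ) + Complex.I * (v : ℂ)) this
      (cont_line v).continuousAt
  have hpc : ∀ v : ℝ, v ≠ 0 → Continuous fun x : ℝ => (A / ((x : ℂ) + Complex.I * (v : ℂ)) ^ 3
      + B / ((x : ℂ) + Complex.I * (v : ℂ)) ^ 2 + C / ((x : ℂ) + Complex.I * (v : ℂ))) := by
    intro v hv
    exact ((continuous_const.div ((cont_line v).pow 3) fun x => pow_ne_zero _ (line_ne hv x)).add
      (continuous_const.div ((cont_line v).pow 2) fun x => pow_ne_zero _ (line_ne hv x))).add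
      (continuous_const.div (cont_line v) fun x => line_ne hv x)
  have hfv : ∀ v : ℝ, v ≠ 0 → c ≤ v → v ≤ d → ∀ x : ℝ, f ((x : ℂ) + Complex.I * (v : ℂ)) =
      (A / ((x : ℂ) + Complex.I * (v : ℂ)) ^ 3
      + B / ((x : ℂ) + Complex.I * (v : ℂ)) ^ 2 + C / ((x : ℂ) + Complex.I * (v : ℂ)))
      + g ((x : ℂ) + Complex.I * (v : ℂ)) := fun v hv h1 h2 x =>
    hfg _ (line_ne hv x) (by simpa) (by simpa)
  have hint : ∀ v : ℝ, v ≠ 0 → c ≤ v → v ≤ d →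
      Integrable (fun x : ℝ => f ((x : ℂ) + Complex.I * (v : ℂ))) := by
    intro v hv h1 h2
    refine integrable_of_exp_bound' (C := K) (T := T) ?_ hδ ?_
    · simp_rw [hfv v hv h1 h2]
      exact (hpc v hv).add (hgc v h1 h2)
    · intro x hx
      simpa using hb ((x : ℂ) + Complex.I * (v : ℂ)) (by simpa) (by simpa) (by simpa)
  have hi1 := hint c hc.ne le_rfl (hc.trans hd).le
  have hi2 := hint d hd.ne' (hc.trans hd).le le_rfl
  refine ⟨hi1, hi2, ?_⟩
  -- horizontal limits
  have hlim : ∀ (v : ℝ) (L : ℂ), v ≠ 0 → c ≤ v → v ≤ d →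
      Tendsto (fun T : ℝ => ∫ x in (-T)..T, 1 / ((x : ℂ) + Complex.I * (v : ℂ))) atTop (𝓝 L) →
      Tendsto (fun T : ℝ => ∫ x in (-T)..T, g ((x : ℂ) + Complex.I * (v : ℂ))) atTop
        (𝓝 ((∫ x : ℝ, f ((x : ℂ) + Complex.I * (v : ℂ))) - C * L)) := by
    intro v L hv h1 h2 hL
    have t1 := intervalIntegral_tendsto_integral (hint v hv h1 h2) tendsto_neg_atTop_atBot
      tendsto_id
    have t2 := t1.sub (poles_lim hv A B C L hL)
    refine t2.congr fun S => ?_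
    simp only [id]
    rw [← intervalIntegral.integral_sub ((hint v hv h1 h2).intervalIntegrable)
      ((hpc v hv).intervalIntegrable _ _)]
    refine intervalIntegral.integral_congr fun x _ => ?_
    simp only [hfv v hv h1 h2]
    ring
  have hl1 := hlim c _ hc.ne le_rfl (hc.trans hd).le (pole1_neg hc)
  have hl2 := hlim d _ hd.ne' (hc.trans hd).le le_rfl (pole1_pos hd)
  -- vertical bound
  let m : ℝ → ℝ := fun S => |K| * Real.exp (-(δ * S)) + ‖A‖ * S⁻¹ ^ 3 + ‖B‖ * S⁻¹ ^ 2 + ‖C‖ * S⁻¹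
  have hm : Tendsto m atTop (𝓝 0) := by
    have e1 : Tendsto (fun S : ℝ => Real.exp (-(δ * S))) atTop (𝓝 0) :=
      Real.tendsto_exp_neg_atTop_nhds_zero.comp (tendsto_id.const_mul_atTop hδ)
    have e2 : Tendsto (fun S : ℝ => S⁻¹) atTop (𝓝 0) := tendsto_inv_atTop_zero
    simpa [m] using (((e1.const_mul |K|).add ((e2.pow 3).const_mul ‖A‖)).add
      ((e2.pow 2).const_mul ‖B‖)).add (e2.const_mul ‖C‖)
  have hgb : ∀ t : ℂ, c ≤ t.im → t.im ≤ d → ∀ S : ℝ, 0 < S → T ≤ S → |t.re| = S →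
      ‖g t‖ ≤ m S := by
    intro t h1 h2 S hS hTS hre
    have ht0 : t ≠ 0 := by rintro rfl; simp at hre; linarith
    have hn : S ≤ ‖t‖ := hre ▸ Complex.abs_re_le_norm t
    have hni : ‖t‖⁻¹ ≤ S⁻¹ := by gcongr
    have hge : g t = f t - A / t ^ 3 - B / t ^ 2 - C / t := by rw [hfg t ht0 h1 h2]; ring
    have b0 : ‖f t‖ ≤ |K| * Real.exp (-(δ * S)) := by
      refine (hb t h1 h2 (by rw [hre]; exact hTS)).trans ?_
      rw [hre]; gcongr; exact le_abs_self K
    have b3 : ‖A / t ^ 3‖ ≤ ‖A‖ * S⁻¹ ^ 3 := by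
      rw [norm_div, norm_pow, div_eq_mul_inv, ← inv_pow]; gcongr
    have b2 : ‖B / t ^ 2‖ ≤ ‖B‖ * S⁻¹ ^ 2 := by
      rw [norm_div, norm_pow, div_eq_mul_inv, ← inv_pow]; gcongr
    have b1 : ‖C / t‖ ≤ ‖C‖ * S⁻¹ := by
      rw [norm_div, div_eq_mul_inv]; gcongr
    rw [hge]
    have := norm_sub_le (f t - A / t ^ 3 - B / t ^ 2) (C / t)
    have := norm_sub_le (f t - A / t ^ 3) (B / t ^ 2)
    have := norm_sub_le (f t) (A / t ^ 3)
    simp only [m]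
    linarith
  have hrect : ∀ S : ℝ, 0 < S → T ≤ S → ‖(∫ x in (-S)..S, g ((x : ℂ) + Complex.I * (c : ℂ)))
      - ∫ x in (-S)..S, g ((x : ℂ) + Complex.I * (d : ℂ))‖ ≤ 2 * ((d - c) * m S) := by
    intro S hS hTS
    have H := Complex.integral_boundary_rect_eq_zero_of_differentiableOn g
      (⟨-S, c⟩ : ℂ) (⟨S, d⟩ : ℂ) (by
        intro t ht
        rw [Complex.mem_reProdIm] at ht
        have h2 := ht.2
        simp only at h2
        rw [uIcc_of_le (hc.trans hd).le] at h2
        exact (hg t h2.1 h2.2).differentiableWithinAt)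
    simp only [mul_comm _ Complex.I] at H
    have v1 : ‖∫ y in c..d, g ((S : ℂ) + Complex.I * (y : ℂ))‖ ≤ m S * |d - c| := by
      refine intervalIntegral.norm_integral_le_of_norm_le_const fun y hy => ?_
      rw [uIoc_of_le (hc.trans hd).le] at hy
      exact hgb _ (by simpa using hy.1.le) (by simpa using hy.2) S hS hTS (by simp [abs_of_pos hS])
    have v2 : ‖∫ y in c..d, g (((-S : ℝ) : ℂ) + Complex.I * (y : ℂ))‖ ≤ m S * |d - c| := by
      refine intervalIntegral.norm_integral_le_of_norm_le_const fun y hy => ?_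
      rw [uIoc_of_le (hc.trans hd).le] at hy
      exact hgb _ (by simpa using hy.1.le) (by simpa using hy.2) S hS hTS (by simp [abs_of_pos hS])
    rw [abs_of_pos (by linarith)] at v1 v2
    have e : (∫ x in (-S)..S, g ((x : ℂ) + Complex.I * (c : ℂ)))
      - ∫ x in (-S)..S, g ((x : ℂ) + Complex.I * (d : ℂ)) =
      Complex.I • (∫ y in c..d, g (((-S : ℝ) : ℂ) + Complex.I * (y : ℂ)))
      - Complex.I • (∫ y in c..d, g ((S : ℂ) + Complex.I * (y : ℂ))) := by
      linear_combination H
    rw [e]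
    refine (norm_sub_le _ _).trans ?_
    rw [norm_smul, norm_smul, Complex.norm_I, one_mul, one_mul]
    linarith
  have hz : Tendsto (fun S : ℝ => (∫ x in (-S)..S, g ((x : ℂ) + Complex.I * (c : ℂ)))
      - ∫ x in (-S)..S, g ((x : ℂ) + Complex.I * (d : ℂ))) atTop (𝓝 0) := by
    apply squeeze_zero_norm' (a := fun S => 2 * ((d - c) * m S))
    · filter_upwards [eventually_gt_atTop 0, eventually_ge_atTop T] with S h1 h2 using hrect S h1 h2
    · simpa using (hm.const_mul (d - c)).const_mul 2
  have := tendsto_nhds_unique hz (hl1.sub hl2)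
  linear_combination -this

end QD

open MeasureTheory

namespace QD
open Filter Topology Set

lemma exp_expansion : ∃ χ : ℂ → ℂ, Differentiable ℂ χ ∧
    ∀ u, Complex.exp u = 1 + u + u ^ 2 / 2 + u ^ 3 / 6 + u ^ 4 * χ u := by
  let f : ℂ → ℂ := fun u => (Complex.exp u - (1 + u + u ^ 2 / 2 + u ^ 3 / 6)) / u ^ 4
  have hd : ∀ s : Set ℂ, DifferentiableOn ℂ f (s \ {0}) := by
    intro s u hu
    have : u ≠ 0 := hu.2
    apply DifferentiableAt.differentiableWithinAt
    have h4 : u ^ 4 ≠ 0 := pow_ne_zero _ this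
    fun_prop (disch := assumption)
  have h1 := Complex.differentiableOn_update_limUnder_of_bddAbove
    (Metric.closedBall_mem_nhds (0 : ℂ) one_pos) (hd _) (by
      refine ⟨1, ?_⟩
      rintro _ ⟨u, ⟨hu, hu0⟩, rfl⟩
      have hu1 : ‖u‖ ≤ 1 := by simpa using hu
      have hu0 : u ≠ 0 := hu0
      have := Complex.exp_bound hu1 (n := 4) (by norm_num)
      simp only [Finset.sum_range_succ, Finset.sum_range_zero] at this
      norm_num [Nat.factorial] at this
      simp only [Function.comp, f, norm_div, norm_pow]
      have hp : 0 < ‖u‖ ^ 4 := by positivity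
      rw [div_le_one hp]
      refine this.trans ?_
      nlinarith)
  refine ⟨Function.update f 0 (limUnder (𝓝[≠] 0) f), ?_, ?_⟩
  · intro u
    by_cases hu : u = 0
    · exact h1.differentiableAt (by rw [hu]; exact Metric.closedBall_mem_nhds (0 : ℂ) one_pos)
    · have h2 : DifferentiableAt ℂ f u :=
        (hd univ).differentiableAt ((isOpen_univ.sdiff isClosed_singleton).mem_nhds ⟨trivial, hu⟩)
      refine h2.congr_of_eventuallyEq ?_
      filter_upwards [isOpen_compl_singleton.mem_nhds hu] with v hv
      exact Function.update_of_ne hv _ _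
  · intro u
    by_cases hu : u = 0
    · simp [hu]
    · rw [Function.update_of_ne hu]
      simp only [f]
      field_simp
      ring

lemma normSq_sinh (u : ℂ) : ‖Complex.sinh u‖ ^ 2 = Real.sinh u.re ^ 2 + Real.sin u.im ^ 2 := by
  have h : Complex.sinh u = ⟨Real.sinh u.re * Real.cos u.im, Real.cosh u.re * Real.sin u.im⟩ := by
    conv_lhs => rw [← Complex.re_add_im u, Complex.sinh_add, Complex.sinh_mul_I, Complex.cosh_mul_I]
    apply Complex.ext
    · simp [← Complex.ofReal_sinh, ← Complex.ofReal_cosh, ← Complex.ofReal_sin, ← Complex.ofReal_cos]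
    · simp [← Complex.ofReal_sinh, ← Complex.ofReal_cosh, ← Complex.ofReal_sin, ← Complex.ofReal_cos]
  rw [← Complex.normSq_eq_norm_sq, h, Complex.normSq_mk]
  have := Real.cosh_sq u.re
  have := Real.sin_sq_add_cos_sq u.im
  have e : Real.cos u.im ^ 2 = 1 - Real.sin u.im ^ 2 := by linarith
  calc _ = Real.sinh u.re ^ 2 * Real.cos u.im ^ 2 + Real.cosh u.re ^ 2 * Real.sin u.im ^ 2 := by ring
    _ = _ := by rw [e, Real.cosh_sq]; ring

lemma exp_abs_le_cosh (x : ℝ) : Real.exp |x| / 2 ≤ Real.cosh x := by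
  rw [← Real.cosh_abs, Real.cosh_eq]
  have := Real.exp_pos (-|x|)
  linarith

/-- lower bound on horizontal lines -/
lemma sinh_line_bound (u : ℂ) : |Real.sin u.im| * (Real.exp |u.re| / 2) ≤ ‖Complex.sinh u‖ := by
  have h : |Real.sin u.im| * Real.cosh u.re ≤ ‖Complex.sinh u‖ := by
    refine abs_le_of_sq_le_sq' ?_ (norm_nonneg _) |>.2
    rw [normSq_sinh, mul_pow, sq_abs, Real.cosh_sq]
    have := Real.sin_sq_le_one u.im
    nlinarith [sq_nonneg (Real.sinh u.re)]
  refine le_trans ?_ h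
  gcongr
  exact exp_abs_le_cosh _

lemma sinh_far_bound (u : ℂ) (hu : 1 ≤ |u.re|) : Real.exp |u.re| / 4 ≤ ‖Complex.sinh u‖ := by
  have h : |Real.sinh u.re| ≤ ‖Complex.sinh u‖ := by
    refine abs_le_of_sq_le_sq' ?_ (norm_nonneg _) |>.2
    rw [normSq_sinh, sq_abs]
    nlinarith [sq_nonneg (Real.sin u.im)]
  refine le_trans ?_ h
  rw [Real.abs_sinh, Real.sinh_eq]
  have h1 : Real.exp (-|u.re|) ≤ 1 := by rw [Real.exp_le_one_iff]; linarith
  have h2 : 1 + 1 ≤ Real.exp |u.re| := by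
    have := Real.add_one_le_exp |u.re|
    linarith
  linarith

lemma sinh_ne_zero {u : ℂ} (hu : u ≠ 0) (h : |u.im| < Real.pi) : Complex.sinh u ≠ 0 := by
  intro h0
  have h1 := normSq_sinh u
  rw [h0] at h1
  simp at h1
  have hs : Real.sin u.im = 0 := by nlinarith [sq_nonneg (Real.sinh u.re), sq_nonneg (Real.sin u.im)]
  have hr : Real.sinh u.re = 0 := by nlinarith [sq_nonneg (Real.sinh u.re), sq_nonneg (Real.sin u.im)]
  rw [Real.sinh_eq_zero] at hr
  rw [abs_lt] at h
  rw [Real.sin_eq_zero_iff_of_lt_of_lt h.1 h.2] at hs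
  exact hu (Complex.ext hr hs)

lemma theta_expansion : ∃ θ : ℂ → ℂ, (∀ u : ℂ, |u.im| < Real.pi → DifferentiableAt ℂ θ u) ∧
    ∀ u : ℂ, u ≠ 0 → |u.im| < Real.pi →
      1 / Complex.sinh u = (1 - u ^ 2 / 6 + u ^ 3 * θ u) / u := by
  obtain ⟨χ, hχ, hexp⟩ := exp_expansion
  let ψ : ℂ → ℂ := fun u => (χ u - χ (-u)) / 2
  have hψ : Differentiable ℂ ψ := (hχ.sub (hχ.comp differentiable_neg)).div_const 2
  let M : ℂ → ℂ := fun u => 1 + u ^ 2 / 6 + u ^ 3 * ψ u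
  have hM : Differentiable ℂ M := by fun_prop
  have hs : ∀ u, Complex.sinh u = u * M u := by
    intro u
    simp only [Complex.sinh, M, ψ]
    rw [hexp u, hexp (-u)]
    ring
  have hM0 : ∀ u : ℂ, |u.im| < Real.pi → M u ≠ 0 := by
    intro u hu h
    by_cases h0 : u = 0
    · rw [h0] at h; simp [M] at h
    · apply sinh_ne_zero h0 hu
      rw [hs, h, mul_zero]
  refine ⟨fun u => (u / 36 - ψ u + u ^ 2 * ψ u / 6) / M u, ?_, ?_⟩
  · intro u hu
    have h1 := hM0 u hu
    exact ((by fun_prop : Differentiable ℂ fun u => (u / 36 - ψ u + u ^ 2 * ψ u / 6)) u).div (hM u) h1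
  · intro u hu0 hu
    have h1 := hM0 u hu
    rw [hs]
    field_simp
    simp only [M]
    ring

end QD

open MeasureTheory

namespace QD
open Filter Topology Set

section fam
variable {h : ℝ → ℂ} {C ρ ε : ℝ}

lemma fam_re (x ε : ℝ) (z : ℂ) : (-(2 * Complex.I * ((x : ℂ) + Complex.I * (ε : ℂ)) * z)).re
    = 2 * ε * z.re + 2 * (x * z.im) := by
  simp
  ring

lemma fam_norm (hC : ∀ x, ‖h x‖ ≤ C * Real.exp (-(ρ * |x|))) (z : ℂ) (x : ℝ) :
    ‖Complex.exp (-(2 * Complex.I * ((x : ℂ) + Complex.I * (ε : ℂ)) * z)) * h x‖ ≤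
      C * Real.exp (2 * ε * z.re) * Real.exp (-((ρ - 2 * |z.im|) * |x|)) := by
  have hC0 : 0 ≤ C := by
    have := (norm_nonneg _).trans (hC 0)
    simpa using this
  rw [norm_mul, Complex.norm_exp, fam_re]
  calc _ ≤ Real.exp (2 * ε * z.re + 2 * (|z.im| * |x|)) * (C * Real.exp (-(ρ * |x|))) := by
        have hx : x * z.im ≤ |z.im| * |x| := by
          rw [← abs_mul, mul_comm]; exact le_abs_self _
        exact mul_le_mul (Real.exp_le_exp.2 (by linarith)) (hC x) (norm_nonneg _)
          (Real.exp_pos _).le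
    _ = _ := by
      rw [Real.exp_add]
      have : Real.exp (-((ρ - 2 * |z.im|) * |x|)) =
          Real.exp (2 * (|z.im| * |x|)) * Real.exp (-(ρ * |x|)) := by
        rw [← Real.exp_add]; ring_nf
      rw [this]; ring

lemma fam_cont (hh : Continuous h) (z : ℂ) : Continuous fun x : ℝ =>
    Complex.exp (-(2 * Complex.I * ((x : ℂ) + Complex.I * (ε : ℂ)) * z)) * h x := by
  fun_prop

lemma fam_int (hh : Continuous h) (hC : ∀ x, ‖h x‖ ≤ C * Real.exp (-(ρ * |x|))) {z : ℂ}
    (hz : |z.im| < ρ / 2) : Integrable fun x : ℝ =>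
    Complex.exp (-(2 * Complex.I * ((x : ℂ) + Complex.I * (ε : ℂ)) * z)) * h x :=
  integrable_of_exp_bound (fam_cont hh z) (by linarith : 0 < ρ - 2 * |z.im|) (fam_norm hC z)

lemma fam_deriv (hε : 0 < ε) (hh : Continuous h) (hC : ∀ x, ‖h x‖ ≤ C * Real.exp (-(ρ * |x|)))
    {z : ℂ} (hz : |z.im| < ρ / 2) :
    HasDerivAt (fun z => ∫ x : ℝ,
      Complex.exp (-(2 * Complex.I * ((x : ℂ) + Complex.I * (ε : ℂ)) * z)) * h x)
      (∫ x : ℝ, -(2 * Complex.I * ((x : ℂ) + Complex.I * (ε : ℂ))) *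
      (Complex.exp (-(2 * Complex.I * ((x : ℂ) + Complex.I * (ε : ℂ)) * z)) * h x)) z := by
  have hC0 : 0 ≤ C := by
    have := (norm_nonneg _).trans (hC 0)
    simpa using this
  obtain ⟨r, hr, hr2⟩ : ∃ r, 0 < r ∧ |z.im| + r < ρ / 2 := ⟨(ρ / 2 - |z.im|) / 2, by linarith, by linarith⟩
  have hd : ∀ x : ℝ, ∀ z : ℂ, HasDerivAt (fun z =>
      Complex.exp (-(2 * Complex.I * ((x : ℂ) + Complex.I * (ε : ℂ)) * z)) * h x)
      (-(2 * Complex.I * ((x : ℂ) + Complex.I * (ε : ℂ))) *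
      (Complex.exp (-(2 * Complex.I * ((x : ℂ) + Complex.I * (ε : ℂ)) * z)) * h x)) z := by
    intro x z
    have := (((hasDerivAt_id z).const_mul
      (2 * Complex.I * ((x : ℂ) + Complex.I * (ε : ℂ)))).neg.cexp).mul_const (h x)
    refine this.congr_deriv ?_
    simp only [id, Pi.neg_apply]
    ring
  have H := hasDerivAt_param (f := fun z x =>
    Complex.exp (-(2 * Complex.I * ((x : ℂ) + Complex.I * (ε : ℂ)) * z)) * h x) (z₀ := z)
    (g := fun x => C * Real.exp (2 * ε * (z.re + r)) *
      Real.exp (-((ρ - 2 * (|z.im| + r)) * |x|))) hr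
    ((integrable_exp_neg_abs (by linarith)).const_mul _)
    (fun w _ => (fam_cont hh w).aestronglyMeasurable)
    (fun x w _ => (hd x w).differentiableAt.differentiableWithinAt) ?_
  · refine H.congr_deriv ?_
    congr 1
    ext x
    exact (hd x z).deriv
  · intro w hw x
    refine (fam_norm hC w x).trans ?_
    rw [Metric.mem_ball, dist_eq_norm] at hw
    have h1 := (Complex.abs_re_le_norm (w - z)).trans hw.le
    have h2 := (Complex.abs_im_le_norm (w - z)).trans hw.le
    rw [Complex.sub_re] at h1
    rw [Complex.sub_im] at h2
    have h3 : w.re ≤ z.re + r := by linarith [le_abs_self (w.re - z.re)]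
    have h4 : |w.im| ≤ |z.im| + r := by linarith [abs_sub_abs_le_abs_sub w.im z.im]
    gcongr

lemma fam_bound (hC : ∀ x, ‖h x‖ ≤ C * Real.exp (-(ρ * |x|)))
    {δ : ℝ} (hδ : 0 < δ) : ∃ M, 0 ≤ M ∧ ∀ z : ℂ, |z.im| ≤ ρ / 2 - δ → ‖∫ x : ℝ,
      Complex.exp (-(2 * Complex.I * ((x : ℂ) + Complex.I * (ε : ℂ)) * z)) * h x‖ ≤
        M * Real.exp (2 * ε * z.re) := by
  have hC0 : 0 ≤ C := by
    have := (norm_nonneg _).trans (hC 0)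
    simpa using this
  refine ⟨C * ∫ x : ℝ, Real.exp (-(2 * δ * |x|)), mul_nonneg hC0 (integral_nonneg fun x => by positivity),
    fun z hz => ?_⟩
  have hi := (integrable_exp_neg_abs (by linarith : 0 < 2 * δ)).const_mul (C * Real.exp (2 * ε * z.re))
  refine (norm_integral_le_of_norm_le hi (Eventually.of_forall fun x => ?_)).trans (le_of_eq ?_)
  · refine (fam_norm hC z x).trans ?_
    gcongr
    linarith
  · rw [integral_const_mul]; ring

end fam

structure Hyp (b ε : ℝ) : Prop where
  hb : 0 < b
  he : 0 < ε
  h1 : b * ε < Real.pi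
  h2 : b⁻¹ * ε < Real.pi

lemma Hyp.s1 {b ε : ℝ} (H : Hyp b ε) : 0 < Real.sin (b * ε) :=
  Real.sin_pos_of_pos_of_lt_pi (mul_pos H.hb H.he) H.h1

lemma Hyp.s2 {b ε : ℝ} (H : Hyp b ε) : 0 < Real.sin (b⁻¹ * ε) :=
  Real.sin_pos_of_pos_of_lt_pi (mul_pos (inv_pos.2 H.hb) H.he) H.h2

lemma sinh_line (p ε x : ℝ) (hp : 0 < p) (hs : 0 < Real.sin (p * ε)) :
    Real.sin (p * ε) / 2 * Real.exp (p * |x|) ≤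
      ‖Complex.sinh ((p : ℂ) * ((x : ℂ) + Complex.I * (ε : ℂ)))‖ := by
  have := sinh_line_bound ((p : ℂ) * ((x : ℂ) + Complex.I * (ε : ℂ)))
  simp [abs_mul, abs_of_pos hp, abs_of_pos hs] at this
  linarith

lemma sinh_line_ne (p ε x : ℝ) (hp : 0 < p) (hs : 0 < Real.sin (p * ε)) :
    Complex.sinh ((p : ℂ) * ((x : ℂ) + Complex.I * (ε : ℂ))) ≠ 0 := by
  have := sinh_line p ε x hp hs
  rw [← norm_pos_iff]
  refine lt_of_lt_of_le ?_ this
  positivity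

/-- kernels -/
noncomputable def kS (b ε x : ℝ) : ℂ := 1 / (4 * ((x : ℂ) + Complex.I * (ε : ℂ)) *
  Complex.sinh ((b : ℂ) * ((x : ℂ) + Complex.I * (ε : ℂ))) *
  Complex.sinh (((x : ℂ) + Complex.I * (ε : ℂ)) / (b : ℂ)))

noncomputable def kK (b ε x : ℝ) : ℂ :=
  1 / Complex.sinh (((x : ℂ) + Complex.I * (ε : ℂ)) / (b : ℂ))

noncomputable def kJ (b ε x : ℝ) : ℂ :=
  1 / (((x : ℂ) + Complex.I * (ε : ℂ)) * Complex.sinh (((x : ℂ) + Complex.I * (ε : ℂ)) / (b : ℂ)))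

lemma div_b (b : ℝ) (t : ℂ) : t / (b : ℂ) = ((b⁻¹ : ℝ) : ℂ) * t := by
  push_cast; rw [div_eq_mul_inv, mul_comm]

lemma kK_cont {b ε : ℝ} (H : Hyp b ε) : Continuous (kK b ε) := by
  unfold kK
  simp only [div_b b]
  refine continuous_const.div (by fun_prop) fun x => sinh_line_ne _ _ x (inv_pos.2 H.hb) H.s2

lemma kJ_cont {b ε : ℝ} (H : Hyp b ε) : Continuous (kJ b ε) := by
  unfold kJ
  simp only [div_b b]
  refine continuous_const.div (by fun_prop) fun x => mul_ne_zero (line_ne H.he.ne' x)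
    (sinh_line_ne _ _ x (inv_pos.2 H.hb) H.s2)

lemma kS_cont {b ε : ℝ} (H : Hyp b ε) : Continuous (kS b ε) := by
  unfold kS
  simp only [div_b b]
  refine continuous_const.div (by fun_prop) fun x => mul_ne_zero (mul_ne_zero (mul_ne_zero
    (by norm_num) (line_ne H.he.ne' x)) (sinh_line_ne _ _ x H.hb H.s1))
    (sinh_line_ne _ _ x (inv_pos.2 H.hb) H.s2)

lemma line_norm_ge' {ε : ℝ} (he : 0 < ε) (x : ℝ) : ε ≤ ‖(x : ℂ) + Complex.I * (ε : ℂ)‖ := by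
  have := Complex.abs_im_le_norm ((x : ℂ) + Complex.I * (ε : ℂ))
  simp at this
  exact (le_abs_self _).trans this

lemma kK_bound {b ε : ℝ} (H : Hyp b ε) :
    ∃ C, ∀ x, ‖kK b ε x‖ ≤ C * Real.exp (-(b⁻¹ * |x|)) := by
  refine ⟨(Real.sin (b⁻¹ * ε) / 2)⁻¹, fun x => ?_⟩
  unfold kK
  rw [div_b, norm_div, norm_one, one_div, Real.exp_neg, ← mul_inv]
  have := H.s2
  gcongr
  exact sinh_line _ _ _ (inv_pos.2 H.hb) H.s2

lemma kJ_bound {b ε : ℝ} (H : Hyp b ε) :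
    ∃ C, ∀ x, ‖kJ b ε x‖ ≤ C * Real.exp (-(b⁻¹ * |x|)) := by
  refine ⟨(ε * (Real.sin (b⁻¹ * ε) / 2))⁻¹, fun x => ?_⟩
  unfold kJ
  rw [div_b, norm_div, norm_one, one_div, Real.exp_neg, ← mul_inv, norm_mul, mul_assoc]
  have := H.s2
  have := H.he
  gcongr
  · exact line_norm_ge' H.he x
  · exact sinh_line _ _ _ (inv_pos.2 H.hb) H.s2

lemma kS_bound {b ε : ℝ} (H : Hyp b ε) :
    ∃ C, ∀ x, ‖kS b ε x‖ ≤ C * Real.exp (-((b + b⁻¹) * |x|)) := by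
  refine ⟨(4 * ε * (Real.sin (b * ε) / 2) * (Real.sin (b⁻¹ * ε) / 2))⁻¹, fun x => ?_⟩
  unfold kS
  have e : (4 * ε * (Real.sin (b * ε) / 2) * (Real.sin (b⁻¹ * ε) / 2)) *
    Real.exp ((b + b⁻¹) * |x|) = 4 * ε * (Real.sin (b * ε) / 2 * Real.exp (b * |x|)) *
      (Real.sin (b⁻¹ * ε) / 2 * Real.exp (b⁻¹ * |x|)) := by
    rw [add_mul, Real.exp_add]; ring
  rw [div_b, norm_div, norm_one, one_div, Real.exp_neg, ← mul_inv, e, norm_mul, norm_mul, norm_mul]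
  have := H.s2
  have := H.s1
  have := H.he
  gcongr
  · simp
  · exact line_norm_ge' H.he x
  · exact sinh_line _ _ _ H.hb H.s1
  · exact sinh_line _ _ _ (inv_pos.2 H.hb) H.s2

end QD

open MeasureTheory

namespace QD
open Filter Topology Set

noncomputable def Sk (b ε : ℝ) (z : ℂ) : ℂ := ∫ x : ℝ,
  Complex.exp (-(2 * Complex.I * ((x : ℂ) + Complex.I * (ε : ℂ)) * z)) * kS b ε x

/-- the integrand on the plane -/
noncomputable def fS (b : ℝ) (z t : ℂ) : ℂ :=
  Complex.exp (-(2 * Complex.I * t * z)) /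
    (4 * t * Complex.sinh ((b : ℂ) * t) * Complex.sinh (((b⁻¹ : ℝ) : ℂ) * t))

lemma fS_far {b ε : ℝ} (H : Hyp b ε) (z : ℂ) (t : ℂ) (h1 : -ε ≤ t.im) (h2 : t.im ≤ ε)
    (hT : max 1 (max b b⁻¹) ≤ |t.re|) : ‖fS b z t‖ ≤
      (4 * Real.exp (2 * (ε * |z.re|))) * Real.exp (-((b + b⁻¹ - 2 * |z.im|) * |t.re|)) := by
  have hb := H.hb
  have hbi := inv_pos.2 H.hb
  have t1 : 1 ≤ |t.re| := (le_max_left _ _).trans hT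
  have t2 : b ≤ |t.re| := ((le_max_left _ _).trans (le_max_right _ _)).trans hT
  have t3 : b⁻¹ ≤ |t.re| := ((le_max_right _ _).trans (le_max_right _ _)).trans hT
  have n1 : 1 ≤ ‖t‖ := t1.trans (Complex.abs_re_le_norm t)
  have re1 : |((b : ℂ) * t).re| = b * |t.re| := by simp [abs_mul, abs_of_pos hb]
  have re2 : |(((b⁻¹ : ℝ) : ℂ) * t).re| = b⁻¹ * |t.re| := by
    rw [Complex.re_ofReal_mul, abs_mul, abs_of_pos hbi]
  have n2 := sinh_far_bound ((b : ℂ) * t) (by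
    rw [re1]; calc (1 : ℝ) = b * b⁻¹ := (mul_inv_cancel₀ hb.ne').symm
      _ ≤ _ := by gcongr)
  have n3 := sinh_far_bound (((b⁻¹ : ℝ) : ℂ) * t) (by
    rw [re2]; calc (1 : ℝ) = b⁻¹ * b := (inv_mul_cancel₀ hb.ne').symm
      _ ≤ _ := by gcongr)
  rw [re1] at n2
  rw [re2] at n3
  have ne : ‖Complex.exp (-(2 * Complex.I * t * z))‖ ≤
      Real.exp (2 * (ε * |z.re|)) * Real.exp (2 * (|z.im| * |t.re|)) := by
    rw [Complex.norm_exp, ← Real.exp_add, Real.exp_le_exp]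
    have : (-(2 * Complex.I * t * z)).re = 2 * (t.im * z.re) + 2 * (t.re * z.im) := by
      simp; ring
    rw [this]
    have a1 : t.im * z.re ≤ ε * |z.re| := by
      refine (le_abs_self _).trans ?_
      rw [abs_mul]
      gcongr
      exact abs_le.2 ⟨h1, h2⟩
    have a2 : t.re * z.im ≤ |z.im| * |t.re| := by
      rw [← abs_mul, mul_comm]; exact le_abs_self _
    linarith
  unfold fS
  rw [norm_div, norm_mul, norm_mul, norm_mul, div_le_iff₀ (mul_pos (mul_pos (mul_pos (by simp)
    (by linarith)) (lt_of_lt_of_le (by positivity) n2)) (lt_of_lt_of_le (by positivity) n3))]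
  refine ne.trans ?_
  have e : Real.exp (-((b + b⁻¹ - 2 * |z.im|) * |t.re|)) * (Real.exp (b * |t.re|) * Real.exp (b⁻¹ * |t.re|)) = Real.exp (2 * (|z.im| * |t.re|)) := by
    rw [← Real.exp_add, ← Real.exp_add]; ring_nf
  calc _ = (4 * Real.exp (2 * (ε * |z.re|))) * Real.exp (-((b + b⁻¹ - 2 * |z.im|) * |t.re|)) *
      (4 * 1 * (Real.exp (b * |t.re|) / 4) * (Real.exp (b⁻¹ * |t.re|) / 4)) := by
        rw [← e]; ring
    _ ≤ _ := by
        have : ‖(4 : ℂ)‖ = 4 := by simp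
        rw [this]
        gcongr

lemma fS_expand {b ε : ℝ} (H : Hyp b ε) (z : ℂ) : ∃ g : ℂ → ℂ,
    (∀ t : ℂ, -ε ≤ t.im → t.im ≤ ε → DifferentiableAt ℂ g t) ∧
    ∀ t ≠ 0, -ε ≤ t.im → t.im ≤ ε → fS b z t = (1 / 4) / t ^ 3 + (-(2 * Complex.I * z) / 4) / t ^ 2 +
      (((-(2 * Complex.I * z)) ^ 2 / 2 - ((b : ℂ) ^ 2 + ((b⁻¹ : ℝ) : ℂ) ^ 2) / 6) / 4) / t + g t := by
  obtain ⟨χ, hχ, hexp⟩ := exp_expansion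
  obtain ⟨θ, hθ, hth⟩ := theta_expansion
  have hb := H.hb
  have hbi := inv_pos.2 H.hb
  have im1 : ∀ t : ℂ, -ε ≤ t.im → t.im ≤ ε → |((b : ℂ) * t).im| < Real.pi := by
    intro t h1 h2
    rw [Complex.im_ofReal_mul, abs_mul, abs_of_pos hb]
    refine lt_of_le_of_lt ?_ H.h1
    gcongr; exact abs_le.2 ⟨h1, h2⟩
  have im2 : ∀ t : ℂ, -ε ≤ t.im → t.im ≤ ε → |(((b⁻¹ : ℝ) : ℂ) * t).im| < Real.pi := by
    intro t h1 h2
    rw [Complex.im_ofReal_mul, abs_mul, abs_of_pos hbi]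
    refine lt_of_le_of_lt ?_ H.h2
    gcongr; exact abs_le.2 ⟨h1, h2⟩
  have hq0 : ((b⁻¹ : ℝ) : ℂ) ≠ 0 := by exact_mod_cast hbi.ne'
  have hp0 : (b : ℂ) ≠ 0 := by exact_mod_cast hb.ne'
  have hpq : (b : ℂ) * ((b⁻¹ : ℝ) : ℂ) = 1 := by push_cast; exact mul_inv_cancel₀ hp0
  generalize ((b⁻¹ : ℝ) : ℂ) = q at *
  generalize hp : (b : ℂ) = p at *
  set k : ℂ := -(2 * Complex.I * z) with hk
  set m : ℂ := -(p ^ 2 + q ^ 2) / 6 with hm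
  let N : ℂ → ℂ := fun t => p ^ 3 * θ (p * t) + q ^ 3 * θ (q * t) + p ^ 2 * q ^ 2 * t / 36 -
    p ^ 2 * q ^ 3 * t ^ 2 * θ (q * t) / 6 - p ^ 3 * q ^ 2 * t ^ 2 * θ (p * t) / 6 +
    p ^ 3 * q ^ 3 * t ^ 3 * θ (p * t) * θ (q * t)
  let X : ℂ → ℂ := fun t => 1 / 6 + k * t * χ (k * t)
  refine ⟨fun t => (1 / 4) * (k ^ 3 * X t * (1 + m * t ^ 2 + t ^ 3 * N t) +
    N t * (1 + k * t + k ^ 2 * t ^ 2 / 2) + k * m + k ^ 2 * m * t / 2), ?_, ?_⟩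
  · intro t h1 h2
    have d1 : DifferentiableAt ℂ (fun t => θ (p * t)) t :=
      (hθ _ (im1 t h1 h2)).comp t (by fun_prop)
    have d2 : DifferentiableAt ℂ (fun t => θ (q * t)) t :=
      (hθ _ (im2 t h1 h2)).comp t (by fun_prop)
    have d3 : DifferentiableAt ℂ (fun t => χ (k * t)) t :=
      (hχ _).comp t (by fun_prop)
    have dN : DifferentiableAt ℂ N t := by
      have d1' := hθ _ (im1 t h1 h2)
      have d2' := hθ _ (im2 t h1 h2)
      clear hθ hth d1 d2
      simp only [N]
      fun_prop
    have dX : DifferentiableAt ℂ X t := by fun_prop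
    fun_prop
  · intro t t0 h1 h2
    have e1 := hth (p * t) (mul_ne_zero hp0 t0) (im1 t h1 h2)
    have e2 := hth (q * t) (mul_ne_zero hq0 t0) (im2 t h1 h2)
    have e3 := hexp (k * t)
    have e4 : fS b z t = Complex.exp (k * t) * (1 / Complex.sinh (p * t)) *
        (1 / Complex.sinh (q * t)) / (4 * t) := by
      unfold fS
      have : -(2 * Complex.I * t * z) = k * t := by rw [hk]; ring
      rw [this]
      simp only [div_eq_mul_inv, mul_inv, one_mul]
      have h6 : (((b⁻¹ : ℝ) : ℂ)) = q := by
        have : (b:ℂ) * ((b⁻¹ : ℝ) : ℂ) = p * q := by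
          rw [hpq]; push_cast; rw [hp]; exact mul_inv_cancel₀ hp0
        rw [hp] at this
        exact mul_left_cancel₀ hp0 this
      rw [h6, hp]
      ring
    rw [e4, e1, e2, e3]
    simp only [X, N]
    rw [hm]
    generalize θ (p * t) = A
    generalize θ (q * t) = B
    generalize χ (k * t) = D
    have hq : q = 1 / p := by field_simp; rw [mul_comm]; exact hpq
    rw [hq]
    field_simp
    ring

lemma Sk_add_neg {b ε : ℝ} (H : Hyp b ε) {z : ℂ} (hz : |z.im| < (b + b⁻¹) / 2) :
    Sk b ε z + Sk b ε (-z) = Complex.I * Real.pi * z ^ 2 +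
      Complex.I * Real.pi / 12 * ((b : ℂ) ^ 2 + ((b : ℂ))⁻¹ ^ 2) := by
  obtain ⟨g, hg, hfg⟩ := fS_expand H z
  have he := H.he
  obtain ⟨-, -, h⟩ := contour_shift (by linarith : -ε < 0) he hg hfg
    (by linarith : 0 < b + b⁻¹ - 2 * |z.im|) (fun t h1 h2 h3 => fS_far H z t h1 h2 h3)
  have e1 : Sk b ε z = ∫ x : ℝ, fS b z ((x : ℂ) + Complex.I * (ε : ℂ)) := by
    unfold Sk
    congr 1; ext x
    simp only [kS, fS, div_b b]
    rw [mul_one_div]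
  have e2 : Sk b ε (-z) = - ∫ x : ℝ, fS b z ((x : ℂ) + Complex.I * ((-ε : ℝ) : ℂ)) := by
    unfold Sk
    rw [← integral_neg, ← integral_neg_eq_self]
    congr 1; ext x
    simp only [kS, fS, div_b b]
    have : ((-x : ℝ) : ℂ) + Complex.I * (ε : ℂ) = -((x : ℂ) + Complex.I * ((-ε : ℝ) : ℂ)) := by
      push_cast; ring
    rw [this, mul_one_div]
    simp only [mul_neg, Complex.sinh_neg, neg_mul, neg_neg, div_neg]
  rw [e2, e1]
  rw [← neg_sub] at h
  have h' := neg_eq_iff_eq_neg.1 h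
  rw [sub_eq_add_neg] at h'
  rw [h']
  push_cast
  ring_nf
  simp
  try simp
  try ring

noncomputable def Ek (b ε : ℝ) (z : ℂ) : ℂ := Complex.I * ((Real.pi : ℝ) : ℂ) / 2 * z ^ 2 +
    Complex.I * ((Real.pi : ℝ) : ℂ) / 24 * ((b : ℂ) ^ 2 + ((b : ℂ))⁻¹ ^ 2) - Sk b ε z

lemma Ek_neg {b ε : ℝ} (H : Hyp b ε) {z : ℂ} (hz : |z.im| < (b + b⁻¹) / 2) :
    Ek b ε (-z) = - Ek b ε z := by
  have := Sk_add_neg H hz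
  unfold Ek
  linear_combination - this

lemma Ek_half {b ε : ℝ} (H : Hyp b ε) {z : ℂ} (hz : |z.im| < (b + b⁻¹) / 2) :
    Ek b ε z = (Sk b ε (-z) - Sk b ε z) / 2 := by
  have := Sk_add_neg H hz
  unfold Ek
  linear_combination - this / 2

lemma Sk_int {b ε : ℝ} (H : Hyp b ε) {z : ℂ} (hz : |z.im| < (b + b⁻¹) / 2) :
    Integrable fun x : ℝ => Complex.exp (-(2 * Complex.I * ((x : ℂ) + Complex.I * (ε : ℂ)) * z)) * kS b ε x := by
  obtain ⟨C, hC⟩ := kS_bound H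
  exact fam_int (kS_cont H) hC hz

lemma Ek_diff {b ε : ℝ} (H : Hyp b ε) {z : ℂ} (hz : |z.im| < (b + b⁻¹) / 2) :
    DifferentiableAt ℂ (Ek b ε) z := by
  obtain ⟨C, hC⟩ := kS_bound H
  have : DifferentiableAt ℂ (Sk b ε) z := (fam_deriv H.he (kS_cont H) hC hz).differentiableAt
  unfold Ek
  fun_prop

end QD

open MeasureTheory

namespace QD
open Filter Topology Set
open scoped ComplexConjugate

lemma Sk_bound {b ε : ℝ} (H : Hyp b ε) {δ : ℝ} (hδ : 0 < δ) : ∃ M, 0 ≤ M ∧ ∀ z : ℂ,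
    |z.im| ≤ (b + b⁻¹) / 2 - δ → ‖Sk b ε z‖ ≤ M * Real.exp (2 * ε * z.re) := by
  obtain ⟨C, hC⟩ := kS_bound H
  exact fam_bound hC hδ

lemma Sk_conj (b ε : ℝ) (z : ℂ) : conj (Sk b ε z) = - Sk b ε (conj z) := by
  unfold Sk
  rw [← integral_conj, ← integral_neg, ← integral_neg_eq_self]
  congr 1; ext x
  simp only [kS, div_b b]
  rw [map_mul, map_div₀, ← Complex.exp_conj]
  simp only [map_mul, ← Complex.sinh_conj, map_neg, map_add, Complex.conj_ofReal, Complex.conj_I, map_one,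
    map_ofNat]
  have e : ((-x : ℝ) : ℂ) + -Complex.I * (ε : ℂ) = -((x : ℂ) + Complex.I * (ε : ℂ)) := by
    push_cast; ring
  rw [e]
  simp only [mul_neg, Complex.sinh_neg, neg_mul, neg_neg, div_neg]

lemma Ek_conj (b ε : ℝ) (z : ℂ) : conj (Ek b ε z) = - Ek b ε (conj z) := by
  unfold Ek
  simp only [map_sub, map_add, map_mul, map_div₀, Sk_conj, Complex.conj_I, Complex.conj_ofReal,
    map_pow, map_inv₀, map_ofNat]
  ring

lemma Dfun_eq {b ε : ℝ} (H : Hyp b ε) {α z : ℂ} (h : |α.im| + |z.im| < (b + b⁻¹) / 2) :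
    Dfun b ε α z = Complex.exp (Ek b ε (z + α) - Ek b ε (z - α)) := by
  have h1 : |(z + α).im| < (b + b⁻¹) / 2 := by
    rw [Complex.add_im]; exact lt_of_le_of_lt (abs_add_le _ _) (by linarith)
  have h2 : |(z - α).im| < (b + b⁻¹) / 2 := by
    rw [Complex.sub_im]; exact lt_of_le_of_lt (abs_sub _ _) (by linarith)
  have h1' : |(-(z + α)).im| < (b + b⁻¹) / 2 := by rwa [Complex.neg_im, abs_neg]
  have h2' : |(-(z - α)).im| < (b + b⁻¹) / 2 := by rwa [Complex.neg_im, abs_neg]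
  rw [Ek_half H h1, Ek_half H h2]
  unfold Dfun
  congr 1
  have i1 := Sk_int H h1
  have i2 := Sk_int H h2
  have i1' := Sk_int H h1'
  have i2' := Sk_int H h2'
  have j1 := (i1'.sub i1).div_const 2
  have j2 := (i2'.sub i2).div_const 2
  simp only [Pi.sub_apply] at j1 j2
  unfold Sk
  rw [← integral_sub i1' i1, ← integral_sub i2' i2, ← integral_div, ← integral_div,
    ← integral_sub j1 j2, ← integral_const_mul]
  congr 1; ext x
  simp only [kS]
  set t := (x : ℂ) + Complex.I * (ε : ℂ)
  have c1 : Complex.cos (2 * t * z) * Complex.sin (2 * α * t) * Complex.I * 4 =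
    Complex.exp (-(2 * Complex.I * t * -(z + α))) - Complex.exp (-(2 * Complex.I * t * (z + α)))
    - Complex.exp (-(2 * Complex.I * t * -(z - α))) + Complex.exp (-(2 * Complex.I * t * (z - α))) := by
    have a1 : -(2 * Complex.I * t * -(z + α)) = (2 * t * z) * Complex.I + (2 * α * t) * Complex.I := by ring
    have a2 : -(2 * Complex.I * t * (z + α)) = -((2 * t * z) * Complex.I) + -((2 * α * t) * Complex.I) := by ring
    have a3 : -(2 * Complex.I * t * -(z - α)) = (2 * t * z) * Complex.I + -((2 * α * t) * Complex.I) := by ring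
    have a4 : -(2 * Complex.I * t * (z - α)) = -((2 * t * z) * Complex.I) + (2 * α * t) * Complex.I := by ring
    rw [a1, a2, a3, a4, Complex.exp_add, Complex.exp_add, Complex.exp_add, Complex.exp_add,
      Complex.cos, Complex.sin]
    simp only [neg_mul]
    linear_combination (-(Complex.exp (2 * t * z * Complex.I) + Complex.exp (-(2 * t * z * Complex.I))) *
      (Complex.exp (-(2 * α * t * Complex.I)) - Complex.exp ((2 * α * t) * Complex.I)) +
      0) * (-1) * Complex.I_sq
  have d0 : ∀ A B D E : ℂ, A / (2 * B * D * E) = 2 * A * (1 / (4 * B * D * E)) := by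
    intros; ring
  rw [d0]
  linear_combination (1 / (4 * t * Complex.sinh ((b : ℂ) * t) * Complex.sinh (t / (b : ℂ)))) / 2 * c1

end QD

open MeasureTheory

namespace QD
open Filter Topology Set

noncomputable def Kk (b ε : ℝ) (z : ℂ) : ℂ := ∫ x : ℝ,
  Complex.exp (-(2 * Complex.I * ((x : ℂ) + Complex.I * (ε : ℂ)) * z)) * kK b ε x
noncomputable def Jk (b ε : ℝ) (z : ℂ) : ℂ := ∫ x : ℝ,
  Complex.exp (-(2 * Complex.I * ((x : ℂ) + Complex.I * (ε : ℂ)) * z)) * kJ b ε x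

lemma Jk_deriv {b ε : ℝ} (H : Hyp b ε) {z : ℂ} (hz : |z.im| < b⁻¹ / 2) :
    HasDerivAt (Jk b ε) (-(2 * Complex.I) * Kk b ε z) z := by
  obtain ⟨C, hC⟩ := kJ_bound H
  refine (fam_deriv H.he (kJ_cont H) hC hz).congr_deriv ?_
  unfold Kk
  rw [← integral_const_mul]
  congr 1; ext x
  simp only [kJ, kK]
  have := line_ne H.he.ne' x
  field_simp

lemma Kk_eq {b ε : ℝ} (H : Hyp b ε) {z : ℂ} (hz : |z.im| < b⁻¹ / 2) :
    -(Complex.exp (-(2 * Real.pi * b * z)) + 1) * Kk b ε z = 2 * Real.pi * Complex.I * b := by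
  have hb := H.hb
  have he := H.he
  have hbi := inv_pos.2 H.hb
  have hb0 : (b : ℂ) ≠ 0 := by exact_mod_cast hb.ne'
  have hpi := Real.pi_pos
  have hεb : ε < Real.pi * b := by
    have := H.h2
    rwa [inv_mul_lt_iff₀ hb, mul_comm] at this
  obtain ⟨χ, hχ, hexp⟩ := exp_expansion
  obtain ⟨θ, hθ, hth⟩ := theta_expansion
  set k : ℂ := -(2 * Complex.I * z) with hk
  have im2 : ∀ t : ℂ, ε - Real.pi * b ≤ t.im → t.im ≤ ε → |(((b⁻¹ : ℝ) : ℂ) * t).im| < Real.pi := by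
    intro t h1 h2
    rw [Complex.im_ofReal_mul, abs_mul, abs_of_pos hbi]
    have : |t.im| < Real.pi * b := abs_lt.2 ⟨by linarith, by linarith⟩
    rw [inv_mul_lt_iff₀ hb, mul_comm]; exact this
  let f : ℂ → ℂ := fun t => Complex.exp (-(2 * Complex.I * t * z)) / Complex.sinh (((b⁻¹ : ℝ) : ℂ) * t)
  let g : ℂ → ℂ := fun t => b * k * (1 + k * t / 2 + (k * t) ^ 2 / 6 + (k * t) ^ 3 * χ (k * t)) +
    Complex.exp (k * t) * (-(((b⁻¹ : ℝ) : ℂ) * t) / 6 + (((b⁻¹ : ℝ) : ℂ) * t) ^ 2 * θ (((b⁻¹ : ℝ) : ℂ) * t))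
  have hg : ∀ t : ℂ, ε - Real.pi * b ≤ t.im → t.im ≤ ε → DifferentiableAt ℂ g t := by
    intro t h1 h2
    have d1 := hθ _ (im2 t h1 h2)
    have d3 : DifferentiableAt ℂ (fun t => χ (k * t)) t := (hχ _).comp t (by fun_prop)
    clear hθ hth
    simp only [g]
    fun_prop
  have hfg : ∀ t : ℂ, t ≠ 0 → ε - Real.pi * b ≤ t.im → t.im ≤ ε →
      f t = 0 / t ^ 3 + 0 / t ^ 2 + b / t + g t := by
    intro t t0 h1 h2
    have e2 := hth _ (mul_ne_zero (by exact_mod_cast hbi.ne') t0) (im2 t h1 h2)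
    have e3 := hexp (k * t)
    have e4 : f t = Complex.exp (k * t) * (1 / Complex.sinh (((b⁻¹ : ℝ) : ℂ) * t)) := by
      simp only [f]
      rw [mul_one_div, hk]; congr 2; ring
    rw [e4, e2]
    simp only [g]
    rw [e3]
    generalize θ (((b⁻¹ : ℝ) : ℂ) * t) = B
    generalize χ (k * t) = D
    push_cast
    field_simp
    ring
  have hfar : ∀ t : ℂ, ε - Real.pi * b ≤ t.im → t.im ≤ ε → b ≤ |t.re| → ‖f t‖ ≤
      (4 * Real.exp (2 * (Real.pi * b * |z.re|))) * Real.exp (-((b⁻¹ - 2 * |z.im|) * |t.re|)) := by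
    intro t h1 h2 t2
    have re2 : |(((b⁻¹ : ℝ) : ℂ) * t).re| = b⁻¹ * |t.re| := by
      rw [Complex.re_ofReal_mul, abs_mul, abs_of_pos hbi]
    have n3 := sinh_far_bound (((b⁻¹ : ℝ) : ℂ) * t) (by
      rw [re2]; calc (1 : ℝ) = b⁻¹ * b := (inv_mul_cancel₀ hb.ne').symm
        _ ≤ _ := by gcongr)
    rw [re2] at n3
    have ne : ‖Complex.exp (-(2 * Complex.I * t * z))‖ ≤
        Real.exp (2 * (Real.pi * b * |z.re|)) * Real.exp (2 * (|z.im| * |t.re|)) := by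
      rw [Complex.norm_exp, ← Real.exp_add, Real.exp_le_exp]
      have : (-(2 * Complex.I * t * z)).re = 2 * (t.im * z.re) + 2 * (t.re * z.im) := by
        simp; ring
      rw [this]
      have a1 : t.im * z.re ≤ Real.pi * b * |z.re| := by
        refine (le_abs_self _).trans ?_
        rw [abs_mul]
        gcongr
        exact abs_le.2 ⟨by linarith, by linarith⟩
      have a2 : t.re * z.im ≤ |z.im| * |t.re| := by
        rw [← abs_mul, mul_comm]; exact le_abs_self _
      linarith
    simp only [f]
    rw [norm_div, div_le_iff₀ (lt_of_lt_of_le (by positivity) n3)]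
    refine ne.trans ?_
    have e : Real.exp (-((b⁻¹ - 2 * |z.im|) * |t.re|)) * (Real.exp (b⁻¹ * |t.re|)) = Real.exp (2 * (|z.im| * |t.re|)) := by
      rw [← Real.exp_add]; ring_nf
    calc _ = (4 * Real.exp (2 * (Real.pi * b * |z.re|))) * Real.exp (-((b⁻¹ - 2 * |z.im|) * |t.re|)) *
        (Real.exp (b⁻¹ * |t.re|) / 4) := by
          rw [← e]; ring
      _ ≤ _ := by gcongr
  obtain ⟨-, -, h⟩ := contour_shift (by linarith : ε - Real.pi * b < 0) he hg hfg
    (by linarith : 0 < b⁻¹ - 2 * |z.im|) hfar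
  have e1 : ∫ x : ℝ, f ((x : ℂ) + Complex.I * (ε : ℂ)) = Kk b ε z := by
    unfold Kk
    congr 1; ext x
    simp only [kK, f, div_b b]
    rw [mul_one_div]
  have e2 : ∫ x : ℝ, f ((x : ℂ) + Complex.I * ((ε - Real.pi * b : ℝ) : ℂ)) =
      -Complex.exp (-(2 * Real.pi * b * z)) * Kk b ε z := by
    unfold Kk
    rw [← integral_const_mul]
    congr 1; ext x
    simp only [kK, f, div_b b]
    have a1 : ((b⁻¹ : ℝ) : ℂ) * ((x : ℂ) + Complex.I * ((ε - Real.pi * b : ℝ) : ℂ)) =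
      ((b⁻¹ : ℝ) : ℂ) * ((x : ℂ) + Complex.I * (ε : ℂ)) - Real.pi * Complex.I := by
      push_cast
      field_simp
      ring
    have a2 : -(2 * Complex.I * ((x : ℂ) + Complex.I * ((ε - Real.pi * b : ℝ) : ℂ)) * z) =
      -(2 * Real.pi * b * z) + -(2 * Complex.I * ((x : ℂ) + Complex.I * (ε : ℂ)) * z) := by
      push_cast
      linear_combination (2 * Real.pi * b * z) * Complex.I_sq
    rw [a1, a2, Complex.exp_add, Complex.sinh_sub, Complex.sinh_mul_I, Complex.cosh_mul_I]
    simp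
    ring
  rw [e1, e2] at h
  linear_combination h

lemma Jk_eq {b ε : ℝ} (H : Hyp b ε) {z : ℂ} (hz : |z.im| < b⁻¹ / 2) :
    Complex.exp (Jk b ε z / 2) * (1 + Complex.exp (2 * Real.pi * b * z)) = 1 := by
  have hb := H.hb
  have hpi := Real.pi_pos
  let V : ℂ → ℂ := fun z => Complex.exp (Jk b ε z / 2) * (1 + Complex.exp (2 * Real.pi * b * z))
  have hV : ∀ w : ℂ, |w.im| < b⁻¹ / 2 → HasDerivAt V 0 w := by
    intro w hw
    have h1 := ((Jk_deriv H hw).div_const 2).cexp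
    have h2 := (((hasDerivAt_id w).const_mul (2 * (Real.pi : ℂ) * b)).cexp).const_add 1
    refine (h1.mul h2).congr_deriv ?_
    have hK := Kk_eq H hw
    rw [Complex.exp_neg] at hK
    have hne := Complex.exp_ne_zero (2 * Real.pi * b * w)
    simp only [id]
    generalize Complex.exp (2 * Real.pi * b * w) = e at *
    field_simp at hK
    linear_combination Complex.exp (Jk b ε w / 2) * Complex.I * hK +
      Complex.exp (Jk b ε w / 2) * 2 * Real.pi * b * e * Complex.I_sq
  let v : ℝ → ℂ := fun x => V (z + x)
  have him : ∀ x : ℝ, (z + x).im = z.im := by intro x; simp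
  have hv : ∀ x : ℝ, HasDerivAt v 0 x := by
    intro x
    exact ((hV (z + x) (by rwa [him])).comp_const_add z (x : ℂ)).comp_ofReal
  have hconst : ∀ x, v x = v 0 := fun x =>
    is_const_of_deriv_eq_zero (fun x => (hv x).differentiableAt) (fun x => (hv x).deriv) x 0
  have hlim : Tendsto v atBot (𝓝 1) := by
    obtain ⟨C, hC⟩ := kJ_bound H
    obtain ⟨M, hM0, hM⟩ := fam_bound (ε := ε) hC (δ := b⁻¹ / 2 - |z.im|) (by linarith)
    have t1 : Tendsto (fun x : ℝ => Jk b ε (z + x)) atBot (𝓝 0) := by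
      refine squeeze_zero_norm (a := fun x : ℝ => M * Real.exp (2 * ε * z.re + 2 * ε * x)) ?_ ?_
      · intro x
        refine (hM (z + x) (by rw [him]; linarith)).trans (le_of_eq ?_)
        simp; ring_nf
        simp
      · have he := H.he
        have : Tendsto (fun x : ℝ => 2 * ε * z.re + 2 * ε * x) atBot atBot :=
          tendsto_atBot_add_const_left _ _ (tendsto_id.const_mul_atBot (by positivity))
        simpa using (Real.tendsto_exp_atBot.comp this).const_mul M
    have t2 : Tendsto (fun x : ℝ => Complex.exp (2 * Real.pi * b * (z + x))) atBot (𝓝 0) := by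
      rw [tendsto_zero_iff_norm_tendsto_zero]
      have e : ∀ x : ℝ, ‖Complex.exp (2 * Real.pi * b * (z + x))‖ =
          Real.exp (2 * Real.pi * b * z.re + 2 * Real.pi * b * x) := by
        intro x
        rw [Complex.norm_exp]
        simp; ring
      simp only [e]
      have : Tendsto (fun x : ℝ => 2 * Real.pi * b * z.re + 2 * Real.pi * b * x) atBot atBot :=
        tendsto_atBot_add_const_left _ _ (tendsto_id.const_mul_atBot (by positivity))
      exact Real.tendsto_exp_atBot.comp this
    have t3 := ((Complex.continuous_exp.tendsto _).comp (t1.div_const 2)).mul (t2.const_add 1)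
    simpa using t3
  have hl2 : Tendsto v atBot (𝓝 (v 0)) := by
    rw [show v = fun _ => v 0 from funext hconst]
    exact tendsto_const_nhds
  have := tendsto_nhds_unique hl2 hlim
  simpa [v, V] using this

lemma Ek_func {b ε : ℝ} (H : Hyp b ε) {z : ℂ} (hz : |z.im| < b⁻¹ / 2) :
    Complex.exp (Ek b ε (z + Complex.I * (b / 2))) =
      2 * Complex.cosh (Real.pi * b * z) * Complex.exp (Ek b ε (z - Complex.I * (b / 2))) := by
  have hb := H.hb
  have h1 : |(z + Complex.I * (b / 2)).im| < (b + b⁻¹) / 2 := by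
    have : (z + Complex.I * (b / 2)).im = z.im + b / 2 := by simp
    rw [this]
    have := abs_lt.1 hz
    exact abs_lt.2 ⟨by linarith, by linarith⟩
  have h2 : |(z - Complex.I * (b / 2)).im| < (b + b⁻¹) / 2 := by
    have : (z - Complex.I * (b / 2)).im = z.im - b / 2 := by simp
    rw [this]
    have := abs_lt.1 hz
    exact abs_lt.2 ⟨by linarith, by linarith⟩
  have hJ : Sk b ε (z + Complex.I * (b / 2)) - Sk b ε (z - Complex.I * (b / 2)) = Jk b ε z / 2 := by
    unfold Sk Jk
    rw [← integral_sub (Sk_int H h1) (Sk_int H h2), ← integral_div]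
    congr 1; ext x
    simp only [kS, kJ]
    have s0 := sinh_line_ne b ε x hb H.s1
    set t := (x : ℂ) + Complex.I * (ε : ℂ) with ht
    have a1 : -(2 * Complex.I * t * (z + Complex.I * (b / 2))) = -(2 * Complex.I * t * z) + b * t := by
      linear_combination -(t * b) * Complex.I_sq
    have a2 : -(2 * Complex.I * t * (z - Complex.I * (b / 2))) = -(2 * Complex.I * t * z) + -(b * t) := by
      linear_combination (t * b) * Complex.I_sq
    have a3 : Complex.exp (b * t) - Complex.exp (-(b * t)) = 2 * Complex.sinh (b * t) := by
      rw [Complex.sinh]; ring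
    rw [a1, a2, Complex.exp_add, Complex.exp_add, ← sub_mul, ← mul_sub, a3]
    have : ∀ A t s u : ℂ, s ≠ 0 → A * (2 * s) * (1 / (4 * t * s * u)) = A * (1 / (t * u)) / 2 := by
      intro A t s u hs
      calc _ = A * (1 / (t * u)) / 2 * (s * s⁻¹) := by ring
        _ = _ := by rw [mul_inv_cancel₀ hs, mul_one]
    exact this _ _ _ _ s0
  have hE : Ek b ε (z + Complex.I * (b / 2)) =
      Ek b ε (z - Complex.I * (b / 2)) + (-(Real.pi * b * z) + -(Jk b ε z / 2)) := by
    unfold Ek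
    linear_combination - hJ + Real.pi * b * z * Complex.I_sq
  have hJ2 := Jk_eq H hz
  have h3 : Complex.exp (-(Jk b ε z / 2)) = 1 + Complex.exp (2 * Real.pi * b * z) := by
    rw [Complex.exp_neg]
    exact inv_eq_of_mul_eq_one_right hJ2
  have h4 : 2 * Real.pi * b * z = Real.pi * b * z + Real.pi * b * z := by ring
  rw [hE, Complex.exp_add, Complex.exp_add, h3, h4, Complex.exp_add, Complex.cosh, Complex.exp_neg]
  have := Complex.exp_ne_zero (Real.pi * b * z)
  field_simp
  ring

end QD

open MeasureTheory

namespace QD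
open Filter Topology Set

noncomputable def Dk (b ε : ℝ) (α z : ℂ) : ℂ := Complex.exp (Ek b ε (z + α) - Ek b ε (z - α))

lemma im_add_lt {α z : ℂ} {r : ℝ} (h : |α.im| + |z.im| < r) : |(z + α).im| < r := by
  rw [Complex.add_im]; exact lt_of_le_of_lt (abs_add_le _ _) (by linarith)
lemma im_sub_lt {α z : ℂ} {r : ℝ} (h : |α.im| + |z.im| < r) : |(z - α).im| < r := by
  rw [Complex.sub_im]; exact lt_of_le_of_lt (abs_sub _ _) (by linarith)
lemma im_add_le {α z : ℂ} {r : ℝ} (h : |α.im| + |z.im| ≤ r) : |(z + α).im| ≤ r := by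
  rw [Complex.add_im]; exact (abs_add_le _ _).trans (by linarith)
lemma im_sub_le {α z : ℂ} {r : ℝ} (h : |α.im| + |z.im| ≤ r) : |(z - α).im| ≤ r := by
  rw [Complex.sub_im]; exact (abs_sub _ _).trans (by linarith)

lemma Dk_neg (b ε : ℝ) (α z : ℂ) : Dk b ε (-α) z = (Dk b ε α z)⁻¹ := by
  unfold Dk
  rw [← Complex.exp_neg]
  congr 1
  rw [sub_neg_eq_add, ← sub_eq_add_neg]
  ring

lemma Dk_ne (b ε : ℝ) (α z : ℂ) : Dk b ε α z ≠ 0 := Complex.exp_ne_zero _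

section
variable {b ε : ℝ} (H : Hyp b ε)
include H

lemma Dk_log_left (α z : ℂ) : Ek b ε (z + α) - Ek b ε (z - α) =
    2 * Real.pi * Complex.I * α * z + (Sk b ε (z - α) - Sk b ε (z + α)) := by
  unfold Ek; ring

lemma Dk_log_right {α z : ℂ} (h : |α.im| + |z.im| < (b + b⁻¹) / 2) :
    Ek b ε (z + α) - Ek b ε (z - α) =
    -(2 * Real.pi * Complex.I * α * z) + (Sk b ε (-(z + α)) - Sk b ε (-(z - α))) := by
  have e1 := Ek_neg H (im_add_lt h)
  have e2 := Ek_neg H (im_sub_lt h)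
  have : Ek b ε (z + α) - Ek b ε (z - α) = Ek b ε (-(z - α)) - Ek b ε (-(z + α)) := by
    rw [e1, e2]; ring
  rw [this]
  unfold Ek; ring

lemma Dk_even {α z : ℂ} (h : |α.im| + |z.im| < (b + b⁻¹) / 2) :
    Dk b ε α (-z) = Dk b ε α z := by
  unfold Dk
  have e1 := Ek_neg H (im_add_lt h)
  have e2 := Ek_neg H (im_sub_lt h)
  have a1 : -z + α = -(z - α) := by ring
  have a2 : -z - α = -(z + α) := by ring
  rw [a1, a2, e1, e2]
  congr 1; ring

lemma Dk_bound {δ A : ℝ} (hδ : 0 < δ) (hA : 0 ≤ A) : ∃ K, 0 ≤ K ∧ ∀ α z : ℂ,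
    |α.im| + |z.im| ≤ (b + b⁻¹) / 2 - δ → |α.re| ≤ A →
    ‖Dk b ε α z‖ ≤ K * Real.exp (2 * Real.pi * α.im * |z.re|) := by
  obtain ⟨M, hM0, hM⟩ := Sk_bound H hδ
  have he := H.he
  have hb := H.hb
  have hbi := inv_pos.2 hb
  have hpi := Real.pi_pos
  refine ⟨Real.exp (2 * (M * Real.exp (2 * ε * A)) + Real.pi * A * (b + b⁻¹)), by positivity, ?_⟩
  intro α z h hα
  have hre : α.re * z.im ≤ A * ((b + b⁻¹) / 2) ∧ -(α.re * z.im) ≤ A * ((b + b⁻¹) / 2) := by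
    have : |α.re * z.im| ≤ A * ((b + b⁻¹) / 2) := by
      rw [abs_mul]
      have : |z.im| ≤ (b + b⁻¹) / 2 := by linarith [abs_nonneg α.im]
      gcongr
    exact ⟨(le_abs_self _).trans this, (neg_le_abs _).trans this⟩
  have hlt : |α.im| + |z.im| < (b + b⁻¹) / 2 := by linarith
  have key : ∀ u : ℂ, |u.im| ≤ (b + b⁻¹) / 2 - δ → u.re ≤ A → ‖Sk b ε u‖ ≤ M * Real.exp (2 * ε * A) := by
    intro u h1 h2
    refine (hM u h1).trans ?_
    gcongr
  have hα' := abs_le.1 hα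
  unfold Dk
  rw [Complex.norm_exp, ← Real.exp_add, Real.exp_le_exp]
  rcases le_total 0 z.re with hz | hz
  · rw [Dk_log_right H hlt, Complex.add_re, Complex.sub_re]
    have k1 := (Complex.re_le_norm _).trans (key (-(z + α)) (by rw [Complex.neg_im, abs_neg]; exact im_add_le h)
      (by simp; linarith))
    have k2 := (neg_le_abs _).trans ((Complex.abs_re_le_norm _).trans (key (-(z - α)) (by rw [Complex.neg_im, abs_neg]; exact im_sub_le h)
      (by simp; linarith)))
    have e : (-(2 * Real.pi * Complex.I * α * z)).re = 2 * Real.pi * α.im * z.re + 2 * Real.pi * (α.re * z.im) := by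
      simp; ring
    rw [e, abs_of_nonneg hz]
    have := mul_le_mul_of_nonneg_left hre.1 hpi.le
    linarith
  · rw [Dk_log_left H, Complex.add_re, Complex.sub_re]
    have k1 := (Complex.re_le_norm _).trans (key (z - α) (im_sub_le h)
      (by simp; linarith))
    have k2 := (neg_le_abs _).trans ((Complex.abs_re_le_norm _).trans (key (z + α) (im_add_le h)
      (by simp; linarith)))
    have e : (2 * Real.pi * Complex.I * α * z).re = -(2 * Real.pi * α.im * z.re) + 2 * Real.pi * (-(α.re * z.im)) := by
      simp; ring
    rw [e, abs_of_nonpos hz]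
    have := mul_le_mul_of_nonneg_left hre.2 hpi.le
    linarith

lemma Dk_diff {α z : ℂ} (h : |α.im| + |z.im| < (b + b⁻¹) / 2) :
    DifferentiableAt ℂ (fun z => Dk b ε α z) z := by
  have d1 := Ek_diff H (im_add_lt h)
  have d2 := Ek_diff H (im_sub_lt h)
  have e1 : DifferentiableAt ℂ (fun z => Ek b ε (z + α)) z := DifferentiableAt.comp (f := fun z => z + α) z d1 (by fun_prop)
  have e2 : DifferentiableAt ℂ (fun z => Ek b ε (z - α)) z := DifferentiableAt.comp (f := fun z => z - α) z d2 (by fun_prop)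
  exact (e1.sub e2).cexp

lemma Dk_diff' {α z : ℂ} (h : |α.im| + |z.im| < (b + b⁻¹) / 2) :
    DifferentiableAt ℂ (fun α => Dk b ε α z) α := by
  have d1 := Ek_diff H (im_add_lt h)
  have d2 := Ek_diff H (im_sub_lt h)
  have e1 : DifferentiableAt ℂ (fun α => Ek b ε (z + α)) α := d1.comp α (by fun_prop)
  have e2 : DifferentiableAt ℂ (fun α => Ek b ε (z - α)) α := d2.comp α (by fun_prop)
  exact (e1.sub e2).cexp

lemma Dk_cont {α : ℂ} (h : |α.im| < (b + b⁻¹) / 2) : Continuous fun x : ℝ => Dk b ε α x := by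
  rw [continuous_iff_continuousAt]
  intro x
  have := (Dk_diff H (α := α) (z := (x : ℂ)) (by simpa using h)).continuousAt
  exact ContinuousAt.comp (f := fun x : ℝ => (x : ℂ)) (g := fun z => Dk b ε α z) this
    Complex.continuous_ofReal.continuousAt

end

noncomputable def Fint (b ε : ℝ) (α y : ℂ) (x : ℝ) : ℂ :=
  Complex.exp (2 * ((Real.pi : ℝ) : ℂ) * Complex.I * (x : ℂ) * y) * Dk b ε α (x : ℂ)

noncomputable def Fk (b ε : ℝ) (α y : ℂ) : ℂ := ∫ x : ℝ, Fint b ε α y x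

lemma exp_norm (x : ℝ) (y : ℂ) : ‖Complex.exp (2 * ((Real.pi : ℝ) : ℂ) * Complex.I * (x : ℂ) * y)‖ =
    Real.exp (-(2 * Real.pi * (x * y.im))) := by
  rw [Complex.norm_exp]; congr 1; simp; ring

section
variable {b ε : ℝ} (H : Hyp b ε)
include H

lemma Fint_cont {α : ℂ} (y : ℂ) (h : |α.im| < (b + b⁻¹) / 2) : Continuous (Fint b ε α y) := by
  unfold Fint
  have := Dk_cont H h
  fun_prop

lemma Fint_bound {a : ℝ} (h1 : 0 < a) (h2 : a < (b + b⁻¹) / 2) {A c : ℝ} (hA : 0 ≤ A) :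
    ∃ K, 0 ≤ K ∧ ∀ α y : ℂ, |α.im| ≤ a → |α.re| ≤ A → |y.im| ≤ c → ∀ x : ℝ,
    ‖Fint b ε α y x‖ ≤ K * Real.exp (-(2 * Real.pi * (-α.im - c) * |x|)) := by
  obtain ⟨K, hK0, hK⟩ := Dk_bound H (by linarith : 0 < (b + b⁻¹) / 2 - a) hA
  refine ⟨K, hK0, fun α y ha hr hy x => ?_⟩
  have hpi := Real.pi_pos
  have := hK α x (by simpa using ha) hr
  unfold Fint
  rw [norm_mul, exp_norm]
  rw [Complex.ofReal_re] at this
  have l : -(2 * Real.pi * (x * y.im)) ≤ 2 * Real.pi * (c * |x|) := by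
    have : -(x * y.im) ≤ c * |x| := by
      refine (neg_le_abs _).trans ?_
      rw [abs_mul, mul_comm]
      gcongr
    have := mul_le_mul_of_nonneg_left this (by positivity : 0 ≤ 2 * Real.pi)
    linarith
  calc _ ≤ Real.exp (2 * Real.pi * (c * |x|)) * (K * Real.exp (2 * Real.pi * α.im * |x|)) :=
      mul_le_mul (Real.exp_le_exp.2 l) this (norm_nonneg _) (Real.exp_pos _).le
    _ = _ := by
      rw [mul_left_comm, ← Real.exp_add]; ring_nf

lemma Fint_int {α y : ℂ} (h1 : |y.im| < -α.im) (h2 : -α.im < (b + b⁻¹) / 2) :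
    Integrable (Fint b ε α y) := by
  have h0 : 0 < -α.im := lt_of_le_of_lt (abs_nonneg _) h1
  have ha : |α.im| = -α.im := abs_of_neg (by linarith)
  obtain ⟨K, hK0, hK⟩ := Fint_bound H h0 h2 (A := |α.re|) (c := |y.im|) (abs_nonneg _)
  refine integrable_of_exp_bound (Fint_cont H y (by linarith)) ?_ (hK α y ha.le le_rfl le_rfl)
  have := Real.pi_pos
  have : 0 < -α.im - |y.im| := by linarith
  positivity

/-- local uniform domination -/
lemma Fint_dom {α₀ y₀ : ℂ} (h1 : |y₀.im| < -α₀.im) (h2 : -α₀.im < (b + b⁻¹) / 2) :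
    ∃ r > 0, ∃ g : ℝ → ℝ, Integrable g ∧ ∀ α ∈ Metric.ball α₀ r, ∀ y ∈ Metric.ball y₀ r,
      |α.im| < (b + b⁻¹) / 2 ∧ ∀ x, ‖Fint b ε α y x‖ ≤ g x := by
  have h0 : 0 < -α₀.im := lt_of_le_of_lt (abs_nonneg _) h1
  obtain ⟨r, hr, hr1, hr2, hr3⟩ : ∃ r : ℝ, 0 < r ∧ -α₀.im + r < (b + b⁻¹) / 2 ∧ |y₀.im| + 2 * r < -α₀.im ∧
      r < -α₀.im := by
    refine ⟨min (((b + b⁻¹) / 2 + α₀.im) / 2) ((-α₀.im - |y₀.im|) / 3), lt_min (by linarith) (by linarith), ?_, ?_, ?_⟩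
    · linarith [min_le_left (((b + b⁻¹) / 2 + α₀.im) / 2) ((-α₀.im - |y₀.im|) / 3)]
    · linarith [min_le_right (((b + b⁻¹) / 2 + α₀.im) / 2) ((-α₀.im - |y₀.im|) / 3)]
    · linarith [min_le_right (((b + b⁻¹) / 2 + α₀.im) / 2) ((-α₀.im - |y₀.im|) / 3), abs_nonneg y₀.im]
  obtain ⟨K, hK0, hK⟩ := Fint_bound H (by linarith : 0 < -α₀.im + r) hr1
    (A := |α₀.re| + r) (c := |y₀.im| + r) (by positivity)
  have hpi := Real.pi_pos
  refine ⟨r, hr, fun x => K * Real.exp (-(2 * Real.pi * (-α₀.im - r - (|y₀.im| + r)) * |x|)),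
    (integrable_exp_neg_abs (mul_pos (by positivity) (by linarith))).const_mul _, ?_⟩
  intro α hα y hy
  rw [Metric.mem_ball, dist_eq_norm] at hα hy
  have a1 := (Complex.abs_re_le_norm (α - α₀)).trans hα.le
  have a2 := (Complex.abs_im_le_norm (α - α₀)).trans hα.le
  have a3 := (Complex.abs_im_le_norm (y - y₀)).trans hy.le
  rw [Complex.sub_re] at a1
  rw [Complex.sub_im] at a2 a3
  have b1 : |α.re| ≤ |α₀.re| + r := by linarith [abs_sub_abs_le_abs_sub α.re α₀.re]
  have b3 : |y.im| ≤ |y₀.im| + r := by linarith [abs_sub_abs_le_abs_sub y.im y₀.im]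
  have c2 := abs_le.1 a2
  have b2 : |α.im| ≤ -α₀.im + r := abs_le.2 ⟨by linarith, by linarith⟩
  refine ⟨by linarith, fun x => (hK α y b2 b1 b3 x).trans ?_⟩
  have : -α₀.im - r - (|y₀.im| + r) ≤ -α.im - (|y₀.im| + r) := by linarith
  beta_reduce
  gcongr

lemma Fk_diff {α y : ℂ} (h1 : |y.im| < -α.im) (h2 : -α.im < (b + b⁻¹) / 2) :
    DifferentiableAt ℂ (fun y => Fk b ε α y) y := by
  obtain ⟨r, hr, g, hg, hb⟩ := Fint_dom H h1 h2
  have hα := (hb α (Metric.mem_ball_self hr) y (Metric.mem_ball_self hr)).1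
  refine (hasDerivAt_param (f := fun y x => Fint b ε α y x) hr hg
    (fun z _ => (Fint_cont H z hα).aestronglyMeasurable) ?_
    (fun z hz => (hb α (Metric.mem_ball_self hr) z hz).2)).differentiableAt
  intro x
  unfold Fint
  fun_prop

lemma Fk_diff' {α y : ℂ} (h1 : |y.im| < -α.im) (h2 : -α.im < (b + b⁻¹) / 2) :
    DifferentiableAt ℂ (fun α => Fk b ε α y) α := by
  obtain ⟨r, hr, g, hg, hb⟩ := Fint_dom H h1 h2
  refine (hasDerivAt_param (f := fun α x => Fint b ε α y x) hr hg
    (fun z hz => (Fint_cont H y (hb z hz y (Metric.mem_ball_self hr)).1).aestronglyMeasurable) ?_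
    (fun z hz => (hb z hz y (Metric.mem_ball_self hr)).2)).differentiableAt
  intro x z hz
  have := (hb z hz y (Metric.mem_ball_self hr)).1
  unfold Fint
  have := Dk_diff' H (α := z) (z := (x : ℂ)) (by simpa using this)
  exact ((differentiableAt_const _).mul this).differentiableWithinAt

end

end QD

open MeasureTheory

namespace QD
open Filter Topology Set

section
variable {b ε : ℝ} (H : Hyp b ε)
include H

lemma cosh_ne {z : ℂ} (hz : |z.im| < b⁻¹ / 2) : Complex.cosh (Real.pi * b * z) ≠ 0 := by
  intro h
  have := Ek_func H hz
  rw [h] at this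
  simp at this

/-- functional equation of the transform -/
lemma Fk_func {α : ℂ} (h1 : b / 2 < -α.im) (h2 : -α.im < (b + b⁻¹) / 2) (y : ℝ) :
    Fk b ε α (y + Complex.I * (b / 2)) * Complex.sinh (Real.pi * b * (y + (α + Complex.I * (b / 2)))) =
    Fk b ε α (y - Complex.I * (b / 2)) * Complex.sinh (Real.pi * b * ((α + Complex.I * (b / 2)) - y)) := by
  have hb := H.hb
  have hpi := Real.pi_pos
  set γ : ℂ := α + Complex.I * (b / 2) with hγ
  have hγi : γ.im = α.im + b / 2 := by simp [hγ]
  have hγa : |γ.im| = -α.im - b / 2 := by rw [abs_of_neg (by linarith)]; linarith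
  let Φ : ℂ → ℂ := fun t => Complex.exp (2 * Real.pi * Complex.I * y * t) * Dk b ε γ t
  have himt : ∀ t : ℂ, -(b / 2) ≤ t.im → t.im ≤ b / 2 → |γ.im| + |t.im| ≤ (b + b⁻¹) / 2 - ((b + b⁻¹) / 2 + α.im) := by
    intro t t1 t2
    rw [hγa]
    linarith [abs_le.2 ⟨t1, t2⟩]
  have hg : ∀ t : ℂ, -(b / 2) ≤ t.im → t.im ≤ b / 2 → DifferentiableAt ℂ Φ t := by
    intro t t1 t2
    have := Dk_diff H (α := γ) (z := t) (by linarith [himt t t1 t2])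
    exact (by fun_prop : DifferentiableAt ℂ (fun t : ℂ => Complex.exp (2 * Real.pi * Complex.I * y * t)) t).mul this
  obtain ⟨K, hK0, hK⟩ := Dk_bound H (δ := (b + b⁻¹) / 2 + α.im) (by linarith) (abs_nonneg γ.re)
  have hfar : ∀ t : ℂ, -(b / 2) ≤ t.im → t.im ≤ b / 2 → (0 : ℝ) ≤ |t.re| →
      ‖Φ t‖ ≤ (Real.exp (2 * Real.pi * (|y| * (b / 2))) * K) * Real.exp (-((2 * Real.pi * (-α.im - b / 2)) * |t.re|)) := by
    intro t t1 t2 _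
    have k := hK γ t (himt t t1 t2) le_rfl
    have e : ‖Complex.exp (2 * Real.pi * Complex.I * y * t)‖ ≤ Real.exp (2 * Real.pi * (|y| * (b / 2))) := by
      rw [Complex.norm_exp, Real.exp_le_exp]
      have : (2 * Real.pi * Complex.I * y * t).re = 2 * Real.pi * (-(y * t.im)) := by simp; ring
      rw [this]
      gcongr
      refine (neg_le_abs _).trans ?_
      rw [abs_mul]
      gcongr
      exact abs_le.2 ⟨t1, t2⟩
    simp only [Φ]
    rw [norm_mul]
    refine (mul_le_mul e k (norm_nonneg _) (Real.exp_pos _).le).trans (le_of_eq ?_)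
    rw [hγi, ← mul_assoc]
    congr 2; ring
  obtain ⟨-, -, h⟩ := contour_shift (A := 0) (B := 0) (C := 0) (f := Φ) (by linarith : -(b / 2) < 0) (by linarith : 0 < b / 2) hg
    (by intro t _ _ _; simp) (mul_pos (by positivity) (by linarith)) hfar
  rw [mul_zero, sub_eq_zero] at h
  have hbc : (((b / 2 : ℝ)) : ℂ) = (b : ℂ) / 2 := by push_cast; ring
  have hnc : (((-(b / 2) : ℝ)) : ℂ) = -((b : ℂ) / 2) := by push_cast; ring
  have hmul : ∀ z : ℂ, |z.im| < b⁻¹ / 2 → ∀ u v : ℂ, u = z + Complex.I * (b / 2) → v = z - Complex.I * (b / 2) →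
      Complex.exp (Ek b ε u) = 2 * Complex.cosh (Real.pi * b * z) * Complex.exp (Ek b ε v) := by
    intro z hz u v hu hv
    rw [hu, hv]; exact Ek_func H hz
  have hlt : ∀ x : ℝ, |((x : ℂ) - γ).im| < b⁻¹ / 2 ∧ |((x : ℂ) + γ).im| < b⁻¹ / 2 := by
    intro x
    simp only [Complex.sub_im, Complex.add_im, Complex.ofReal_im, zero_sub, zero_add, abs_neg, and_self]
    rw [hγa]; linarith
  have eG1 : ∀ x : ℝ, Dk b ε γ (x - Complex.I * (b / 2)) = 2 * Complex.cosh (Real.pi * b * (x - γ)) * Dk b ε α x := by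
    intro x
    have := hmul (x - γ) (hlt x).1 (x - α) (x - Complex.I * (b / 2) - γ) (by rw [hγ]; ring) (by ring)
    unfold Dk
    have a : (x : ℂ) - Complex.I * (b / 2) + γ = x + α := by rw [hγ]; ring
    rw [a, Complex.exp_sub, Complex.exp_sub, this]
    have := cosh_ne H (hlt x).1
    have := Complex.exp_ne_zero (Ek b ε (x - Complex.I * (b / 2) - γ))
    generalize Complex.cosh (Real.pi * b * (x - γ)) = w at *
    field_simp
  have eG2 : ∀ x : ℝ, Dk b ε γ (x + Complex.I * (b / 2)) = 2 * Complex.cosh (Real.pi * b * (x + γ)) * Dk b ε α x := by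
    intro x
    have := hmul (x + γ) (hlt x).2 (x + Complex.I * (b / 2) + γ) (x + α) (by ring) (by rw [hγ]; ring)
    unfold Dk
    have a : (x : ℂ) + Complex.I * (b / 2) - γ = x - α := by rw [hγ]; ring
    rw [a, Complex.exp_sub, Complex.exp_sub, this]
    ring
  have iy1 : |((y : ℂ) + Complex.I * (b / 2)).im| < -α.im := by
    have : ((y : ℂ) + Complex.I * (b / 2)).im = b / 2 := by simp
    rw [this, abs_of_pos (by linarith)]; exact h1
  have iy2 : |((y : ℂ) - Complex.I * (b / 2)).im| < -α.im := by
    have : ((y : ℂ) - Complex.I * (b / 2)).im = -(b / 2) := by simp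
    rw [this, abs_neg, abs_of_pos (by linarith)]; exact h1
  have I1 := Fint_int H iy1 h2
  have I2 := Fint_int H iy2 h2
  have e1 : ∀ x : ℝ, Φ ((x : ℂ) + Complex.I * ((-(b / 2) : ℝ) : ℂ)) =
      Complex.exp (Real.pi * b * (y - γ)) * Fint b ε α (y - Complex.I * (b / 2)) x +
      Complex.exp (Real.pi * b * (y + γ)) * Fint b ε α (y + Complex.I * (b / 2)) x := by
    intro x
    simp only [Φ, Fint]
    rw [hnc, mul_neg, ← sub_eq_add_neg, eG1, Complex.cosh]
    have a1 : 2 * Real.pi * Complex.I * y * (x - Complex.I * (b / 2)) =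
      2 * Real.pi * Complex.I * x * y + Real.pi * b * y := by
      linear_combination -(Real.pi * y * b) * Complex.I_sq
    have a2 : 2 * Real.pi * Complex.I * x * (y - Complex.I * (b / 2)) =
      2 * Real.pi * Complex.I * x * y + Real.pi * b * x := by
      linear_combination -(Real.pi * x * b) * Complex.I_sq
    have a3 : 2 * Real.pi * Complex.I * x * (y + Complex.I * (b / 2)) =
      2 * Real.pi * Complex.I * x * y - Real.pi * b * x := by
      linear_combination (Real.pi * x * b) * Complex.I_sq
    rw [a1, a2, a3]
    simp only [mul_sub, mul_add, neg_sub, Complex.exp_add, Complex.exp_sub]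
    have := Complex.exp_ne_zero (Real.pi * b * γ)
    have := Complex.exp_ne_zero (Real.pi * b * x)
    field_simp
  have e2 : ∀ x : ℝ, Φ ((x : ℂ) + Complex.I * ((b / 2 : ℝ) : ℂ)) =
      Complex.exp (Real.pi * b * (γ - y)) * Fint b ε α (y - Complex.I * (b / 2)) x +
      Complex.exp (-(Real.pi * b * (y + γ))) * Fint b ε α (y + Complex.I * (b / 2)) x := by
    intro x
    simp only [Φ, Fint]
    rw [hbc, eG2, Complex.cosh]
    have a1 : 2 * Real.pi * Complex.I * y * (x + Complex.I * (b / 2)) =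
      2 * Real.pi * Complex.I * x * y - Real.pi * b * y := by
      linear_combination (Real.pi * y * b) * Complex.I_sq
    have a2 : 2 * Real.pi * Complex.I * x * (y - Complex.I * (b / 2)) =
      2 * Real.pi * Complex.I * x * y + Real.pi * b * x := by
      linear_combination -(Real.pi * x * b) * Complex.I_sq
    have a3 : 2 * Real.pi * Complex.I * x * (y + Complex.I * (b / 2)) =
      2 * Real.pi * Complex.I * x * y - Real.pi * b * x := by
      linear_combination (Real.pi * x * b) * Complex.I_sq
    rw [a1, a2, a3]
    simp only [mul_sub, mul_add, neg_add, Complex.exp_add, Complex.exp_sub, Complex.exp_neg]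
    have := Complex.exp_ne_zero (Real.pi * b * γ)
    have := Complex.exp_ne_zero (Real.pi * b * x)
    have := Complex.exp_ne_zero (Real.pi * b * y)
    field_simp
  simp only [e1, e2] at h
  rw [integral_add (I2.const_mul _) (I1.const_mul _), integral_add (I2.const_mul _) (I1.const_mul _)] at h
  simp only [integral_const_mul] at h
  change _ * Fk b ε α _ + _ * Fk b ε α _ = _ * Fk b ε α _ + _ * Fk b ε α _ at h
  rw [Complex.sinh, Complex.sinh]
  have n1 : -(Real.pi * b * (γ - y)) = Real.pi * b * (y - γ) := by ring
  rw [n1]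
  linear_combination h / 2

lemma Dk_func {β : ℂ} (h : |β.im| < b⁻¹ / 2) (y : ℝ) :
    Dk b ε β (y + Complex.I * (b / 2)) * Complex.cosh (Real.pi * b * (y - β)) =
    Dk b ε β (y - Complex.I * (b / 2)) * Complex.cosh (Real.pi * b * (y + β)) := by
  have h1 : |((y : ℂ) - β).im| < b⁻¹ / 2 := by simpa using h
  have h2 : |((y : ℂ) + β).im| < b⁻¹ / 2 := by simpa using h
  have f1 := Ek_func H h1
  have f2 := Ek_func H h2
  unfold Dk
  have a1 : (y : ℂ) + Complex.I * (b / 2) + β = y + β + Complex.I * (b / 2) := by ring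
  have a2 : (y : ℂ) + Complex.I * (b / 2) - β = y - β + Complex.I * (b / 2) := by ring
  have a3 : (y : ℂ) - Complex.I * (b / 2) + β = y + β - Complex.I * (b / 2) := by ring
  have a4 : (y : ℂ) - Complex.I * (b / 2) - β = y - β - Complex.I * (b / 2) := by ring
  rw [a1, a2, a3, a4, Complex.exp_sub, Complex.exp_sub, f1, f2]
  have := cosh_ne H h1
  have := Complex.exp_ne_zero (Ek b ε (y - β - Complex.I * (b / 2)))
  field_simp

/-- the ratio is periodic -/
lemma ratio_per {α : ℂ} (h1 : b / 2 < -α.im) (h2 : -α.im < (b + b⁻¹) / 2) (y : ℝ) {β : ℂ}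
    (hβ : β = -(Complex.I * (((b + b⁻¹) / 2 : ℝ) : ℂ)) - α) :
    Fk b ε α (y + Complex.I * (b / 2)) / Dk b ε β (y + Complex.I * (b / 2)) =
    Fk b ε α (y - Complex.I * (b / 2)) / Dk b ε β (y - Complex.I * (b / 2)) := by
  have hb := H.hb
  have hb0 : (b : ℂ) ≠ 0 := by exact_mod_cast hb.ne'
  have hβi : β.im = -((b + b⁻¹) / 2) - α.im := by
    rw [hβ, Complex.sub_im, Complex.neg_im, Complex.I_mul_im, Complex.ofReal_re]
  have hβa : |β.im| < b⁻¹ / 2 := by rw [hβi]; exact abs_lt.2 ⟨by linarith, by linarith⟩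
  have f1 := Fk_func H h1 h2 y
  have f2 := Dk_func H hβa y
  have c1 := cosh_ne H (z := y - β) (by simpa using hβa)
  have c2 := cosh_ne H (z := y + β) (by simpa using hβa)
  have a1 : Real.pi * b * (y - β) = Real.pi * b * (y + (α + Complex.I * (b / 2))) + (Real.pi / 2) * Complex.I := by
    rw [hβ]; push_cast; field_simp; ring
  have a2 : Real.pi * b * (y + β) = -(Real.pi * b * ((α + Complex.I * (b / 2)) - y)) - (Real.pi / 2) * Complex.I := by
    rw [hβ]; push_cast; field_simp; ring
  rw [a1, Complex.cosh_add, Complex.cosh_mul_I, Complex.sinh_mul_I] at f2 c1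
  rw [a2, Complex.cosh_sub, Complex.cosh_mul_I, Complex.sinh_mul_I] at f2 c2
  simp only [Complex.cos_pi_div_two, Complex.sin_pi_div_two, mul_zero, zero_add, one_mul, Complex.sinh_neg, zero_sub, neg_mul, neg_neg] at f2 c1 c2
  have s1 := left_ne_zero_of_mul c1
  have s2 := left_ne_zero_of_mul c2
  rw [div_eq_div_iff (Dk_ne _ _ _ _) (Dk_ne _ _ _ _)]
  generalize Complex.sinh (Real.pi * b * (y + (α + Complex.I * (b / 2)))) = u at *
  generalize Complex.sinh (Real.pi * b * ((α + Complex.I * (b / 2)) - y)) = v at *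
  have f3 : Dk b ε β (y + Complex.I * (b / 2)) * u = Dk b ε β (y - Complex.I * (b / 2)) * v := by
    have : Complex.I ≠ 0 := Complex.I_ne_zero
    apply mul_right_cancel₀ this
    linear_combination f2
  apply mul_right_cancel₀ (mul_ne_zero s1 s2)
  linear_combination (Dk b ε β (y - Complex.I * (b / 2)) * v) * f1 - Fk b ε α (y - Complex.I * (b / 2)) * v * f3

end
end QD

open MeasureTheory

namespace QD
open Filter Topology Set

lemma strip_open (a : ℝ) : IsOpen {z : ℂ | |z.im| < a} :=
  isOpen_lt (by fun_prop) (by fun_prop)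

lemma periodic_deriv {b a K η : ℝ} (hb : 0 < b) (ha : b / 2 < a) {R : ℂ → ℂ}
    (hR : ∀ z : ℂ, |z.im| < a → DifferentiableAt ℂ R z)
    (hη0 : 0 ≤ η) (hη : η < 2 * (Real.pi / b)) (hK0 : 0 ≤ K)
    (hK : ∀ z : ℂ, |z.im| ≤ b / 2 → ‖R z‖ ≤ K * Real.exp (η * |z.re|))
    (hper : ∀ y : ℝ, R (y + Complex.I * (b / 2)) = R (y - Complex.I * (b / 2))) (y₀ : ℝ) :
    deriv R y₀ = 0 := by
  have hpi := Real.pi_pos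
  set k : ℝ := Real.pi / b with hk
  have hk0 : 0 < k := by positivity
  have hkc : (k : ℂ) ≠ 0 := by exact_mod_cast hk0.ne'
  have hkb : k * (b / 2) = Real.pi / 2 := by rw [hk]; field_simp
  have hU := strip_open a
  have hy₀ : {z : ℂ | |z.im| < a} ∈ 𝓝 (y₀ : ℂ) := hU.mem_nhds (by simp; linarith)
  have hRo : DifferentiableOn ℂ R {z : ℂ | |z.im| < a} := fun z hz => (hR z hz).differentiableWithinAt
  let R1 := dslope R y₀
  let R2 := dslope R1 y₀
  have d1 : DifferentiableOn ℂ R1 {z : ℂ | |z.im| < a} := (Complex.differentiableOn_dslope hy₀).2 hRo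
  have d2 : DifferentiableOn ℂ R2 {z : ℂ | |z.im| < a} := (Complex.differentiableOn_dslope hy₀).2 d1
  have hexpR : ∀ t : ℂ, R (t + y₀) = R y₀ + deriv R y₀ * t + t ^ 2 * R2 (t + y₀) := by
    intro t
    have e1 := sub_smul_dslope R y₀ (t + y₀)
    have e2 := sub_smul_dslope R1 y₀ (t + y₀)
    have e3 : R1 y₀ = deriv R y₀ := dslope_same _ _
    simp only [add_sub_cancel_right, smul_eq_mul] at e1 e2
    change t * R1 (t + y₀) = _ at e1
    change t * R2 (t + y₀) = _ at e2
    rw [e3] at e2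
    linear_combination - e1 - t * e2
  obtain ⟨θ, hθ, hth⟩ := theta_expansion
  let W : ℂ → ℂ := fun u => u ^ 2 / 36 - 1 / 3 + 2 * u * θ u - u ^ 3 * θ u / 3 + u ^ 4 * θ u ^ 2
  let f : ℂ → ℂ := fun t => R (t + y₀) / Complex.sinh (k * t) ^ 2
  let g : ℂ → ℂ := fun t => R2 (t + y₀) / (k : ℂ) ^ 2 + R (t + y₀) * W (k * t)
  have him : ∀ t : ℂ, -(b / 2) ≤ t.im → t.im ≤ b / 2 → |t.im| ≤ b / 2 := fun t h1 h2 => abs_le.2 ⟨h1, h2⟩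
  have him' : ∀ t : ℂ, (t + y₀).im = t.im := by intro t; simp
  have imk : ∀ t : ℂ, -(b / 2) ≤ t.im → t.im ≤ b / 2 → |((k : ℂ) * t).im| < Real.pi := by
    intro t h1 h2
    rw [Complex.im_ofReal_mul, abs_mul, abs_of_pos hk0]
    calc k * |t.im| ≤ k * (b / 2) := by gcongr; exact him t h1 h2
      _ < Real.pi := by rw [hkb]; linarith
  have hg : ∀ t : ℂ, -(b / 2) ≤ t.im → t.im ≤ b / 2 → DifferentiableAt ℂ g t := by
    intro t h1 h2
    have hm : |(t + y₀).im| < a := by rw [him']; linarith [him t h1 h2]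
    have g1 : DifferentiableAt ℂ (fun t => R2 (t + y₀)) t :=
      DifferentiableAt.comp (f := fun t => t + (y₀ : ℂ)) t (d2.differentiableAt (hU.mem_nhds hm)) (by fun_prop)
    have g2 : DifferentiableAt ℂ (fun t => R (t + y₀)) t :=
      DifferentiableAt.comp (f := fun t => t + (y₀ : ℂ)) t (hR _ hm) (by fun_prop)
    have g3 := hθ _ (imk t h1 h2)
    have g4 : DifferentiableAt ℂ (fun t => W (k * t)) t := by
      clear hθ hth
      simp only [W]
      fun_prop
    exact (g1.div_const _).add (g2.mul g4)
  have hfg : ∀ t : ℂ, t ≠ 0 → -(b / 2) ≤ t.im → t.im ≤ b / 2 →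
      f t = 0 / t ^ 3 + (R y₀ / (k : ℂ) ^ 2) / t ^ 2 + (deriv R y₀ / (k : ℂ) ^ 2) / t + g t := by
    intro t t0 h1 h2
    have e1 := hth (k * t) (mul_ne_zero hkc t0) (imk t h1 h2)
    have e2 : f t = R (t + y₀) * (1 / Complex.sinh (k * t)) ^ 2 := by
      simp only [f]; rw [div_pow, one_pow, mul_one_div]
    rw [e2, e1]
    simp only [g, W]
    rw [hexpR]
    generalize θ (k * t) = A
    generalize R2 (t + y₀) = B
    field_simp
    ring
  have hfar : ∀ t : ℂ, -(b / 2) ≤ t.im → t.im ≤ b / 2 → k⁻¹ ≤ |t.re| →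
      ‖f t‖ ≤ (16 * (K * Real.exp (η * |y₀|))) * Real.exp (-((2 * k - η) * |t.re|)) := by
    intro t h1 h2 h3
    have re2 : |((k : ℂ) * t).re| = k * |t.re| := by
      rw [Complex.re_ofReal_mul, abs_mul, abs_of_pos hk0]
    have n3 := sinh_far_bound ((k : ℂ) * t) (by
      rw [re2]; calc (1 : ℝ) = k * k⁻¹ := (mul_inv_cancel₀ hk0.ne').symm
        _ ≤ _ := by gcongr)
    rw [re2] at n3
    have n4 : ‖R (t + y₀)‖ ≤ K * Real.exp (η * |y₀|) * Real.exp (η * |t.re|) := by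
      refine (hK (t + y₀) (by rw [him']; exact him t h1 h2)).trans ?_
      rw [mul_assoc, ← Real.exp_add]
      gcongr
      rw [← mul_add]
      gcongr
      simp only [Complex.add_re, Complex.ofReal_re]
      linarith [abs_add_le t.re y₀]
    simp only [f]
    rw [norm_div, norm_pow, div_le_iff₀ (pow_pos (lt_of_lt_of_le (by positivity) n3) 2)]
    refine n4.trans ?_
    have e : Real.exp (-((2 * k - η) * |t.re|)) * (Real.exp (k * |t.re|)) ^ 2 = Real.exp (η * |t.re|) := by
      rw [← Real.exp_nat_mul, ← Real.exp_add]; congr 1; push_cast; ring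
    calc _ = (16 * (K * Real.exp (η * |y₀|))) * Real.exp (-((2 * k - η) * |t.re|)) *
        (Real.exp (k * |t.re|) / 4) ^ 2 := by
          rw [← e]; ring
      _ ≤ _ := by gcongr
  obtain ⟨-, -, h⟩ := contour_shift (by linarith : -(b / 2) < 0) (by linarith : 0 < b / 2) hg hfg
    (by linarith : 0 < 2 * k - η) hfar
  have heq : ∀ x : ℝ, f ((x : ℂ) + Complex.I * ((-(b / 2) : ℝ) : ℂ)) = f ((x : ℂ) + Complex.I * ((b / 2 : ℝ) : ℂ)) := by
    intro x
    simp only [f]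
    have p := hper (x + y₀)
    have a1 : (x : ℂ) + Complex.I * ((-(b / 2) : ℝ) : ℂ) + y₀ = ((x + y₀ : ℝ) : ℂ) - Complex.I * (b / 2) := by
      push_cast; ring
    have a2 : (x : ℂ) + Complex.I * ((b / 2 : ℝ) : ℂ) + y₀ = ((x + y₀ : ℝ) : ℂ) + Complex.I * (b / 2) := by
      push_cast; ring
    have hkb' : (k : ℂ) * (b / 2) = Real.pi / 2 := by exact_mod_cast hkb
    have a3 : (k : ℂ) * ((x : ℂ) + Complex.I * ((-(b / 2) : ℝ) : ℂ)) = k * x - (Real.pi / 2) * Complex.I := by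
      push_cast; linear_combination -Complex.I * hkb'
    have a4 : (k : ℂ) * ((x : ℂ) + Complex.I * ((b / 2 : ℝ) : ℂ)) = k * x + (Real.pi / 2) * Complex.I := by
      push_cast; linear_combination Complex.I * hkb'
    rw [a1, a2, p, a3, a4, Complex.sinh_add, Complex.sinh_sub, Complex.cosh_mul_I, Complex.sinh_mul_I]
    congr 1
    simp
  simp only [heq, sub_self] at h
  have h' := h.symm
  simpa [hpi.ne', hk0.ne', Complex.I_ne_zero] using h'

lemma periodic_const {b a K η : ℝ} (hb : 0 < b) (ha : b / 2 < a) {R : ℂ → ℂ}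
    (hR : ∀ z : ℂ, |z.im| < a → DifferentiableAt ℂ R z)
    (hη0 : 0 ≤ η) (hη : η < 2 * (Real.pi / b)) (hK0 : 0 ≤ K)
    (hK : ∀ z : ℂ, |z.im| ≤ b / 2 → ‖R z‖ ≤ K * Real.exp (η * |z.re|))
    (hper : ∀ y : ℝ, R (y + Complex.I * (b / 2)) = R (y - Complex.I * (b / 2))) {z : ℂ} (hz : |z.im| < a) :
    R z = R 0 := by
  have hder := fun y₀ => periodic_deriv hb ha hR hη0 hη hK0 hK hper y₀
  have hv : ∀ x : ℝ, HasDerivAt (fun x : ℝ => R x) 0 x := by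
    intro x
    have := (hR x (by simp; linarith)).hasDerivAt
    rw [hder] at this
    exact this.comp_ofReal
  have hconst : ∀ x : ℝ, R x = R 0 := fun x => by
    simpa using is_const_of_deriv_eq_zero (f := fun x : ℝ => R x) (fun x => (hv x).differentiableAt) (fun x => (hv x).deriv) x 0
  have hU := strip_open a
  have hRo : DifferentiableOn ℂ R {z : ℂ | |z.im| < a} := fun z hz => (hR z hz).differentiableWithinAt
  have hpre : IsPreconnected {z : ℂ | |z.im| < a} := by
    have : {z : ℂ | |z.im| < a} = Complex.imCLM ⁻¹' (Ioo (-a) a) := by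
      ext z; simp [abs_lt]
    rw [this]
    exact ((convex_Ioo (-a) a).linear_preimage Complex.imCLM.toLinearMap).isPreconnected
  refine (hRo.analyticOnNhd hU).eqOn_of_preconnected_of_frequently_eq (g := fun _ => R 0)
    (analyticOnNhd_const) hpre (z₀ := 0) (by simp; linarith) ?_ hz
  have : Tendsto (fun n : ℕ => ((1 / ((n : ℝ) + 1) : ℝ) : ℂ)) atTop (𝓝[≠] 0) := by
    refine tendsto_nhdsWithin_iff.2 ⟨?_, Eventually.of_forall fun n => ?_⟩
    · have := (Complex.continuous_ofReal.tendsto 0).comp tendsto_one_div_add_atTop_nhds_zero_nat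
      rw [Complex.ofReal_zero] at this
      exact this
    · have : (0 : ℝ) < 1 / ((n : ℝ) + 1) := by positivity
      simp only [mem_compl_iff, mem_singleton_iff]
      exact_mod_cast this.ne'
  exact this.frequently (Frequently.of_forall fun n => hconst _)

end QD

open MeasureTheory

namespace QD
open Filter Topology Set

section
variable {b ε : ℝ} (H : Hyp b ε)
include H

lemma ratio_const {α : ℂ} (h1 : b / 2 < -α.im) (h2 : -α.im < (b + b⁻¹) / 2) {β : ℂ}
    (hβ : β = -(Complex.I * (((b + b⁻¹) / 2 : ℝ) : ℂ)) - α) {y : ℂ} (hy : |y.im| < -α.im) :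
    Fk b ε α y = Fk b ε α 0 / Dk b ε β 0 * Dk b ε β y := by
  have hb := H.hb
  have hbi := inv_pos.2 hb
  have hpi := Real.pi_pos
  have ha0 : 0 < -α.im := by linarith
  have hαa : |α.im| = -α.im := abs_of_neg (by linarith)
  have hβi : β.im = -((b + b⁻¹) / 2) - α.im := by
    rw [hβ, Complex.sub_im, Complex.neg_im, Complex.I_mul_im, Complex.ofReal_re]
  have hβa : |β.im| = (b + b⁻¹) / 2 + α.im := by rw [abs_of_neg (by linarith)]; linarith
  obtain ⟨K1, hK1, hF⟩ := Fint_bound H ha0 h2 (A := |α.re|) (c := b / 2) (abs_nonneg _)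
  obtain ⟨K2, hK2, hD⟩ := Dk_bound H (by linarith : 0 < -α.im - b / 2) (abs_nonneg β.re)
  let C1 := ∫ x : ℝ, K1 * Real.exp (-(2 * Real.pi * (-α.im - b / 2) * |x|))
  have hC1 : 0 ≤ C1 := integral_nonneg fun x => by positivity
  have hFb : ∀ z : ℂ, |z.im| ≤ b / 2 → ‖Fk b ε α z‖ ≤ C1 := by
    intro z hz
    refine norm_integral_le_of_norm_le ((integrable_exp_neg_abs (mul_pos (by positivity) (by linarith))).const_mul _)
      (Eventually.of_forall fun x => hF α z hαa.le le_rfl hz x)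
  have := periodic_const (R := fun z => Fk b ε α z / Dk b ε β z) hb h1
    (K := C1 * K2) (η := 2 * Real.pi * ((b + b⁻¹) / 2 + α.im)) ?_ ?_ ?_ ?_ ?_ ?_ hy
  · rw [← this, div_mul_cancel₀ _ (Dk_ne _ _ _ _)]
  · intro z hz
    exact (Fk_diff H hz h2).div (Dk_diff H (by rw [hβa]; linarith)) (Dk_ne _ _ _ _)
  · exact mul_nonneg (by positivity) (by linarith)
  · have : (b + b⁻¹) / 2 + α.im < b⁻¹ := by linarith
    have e : 2 * (Real.pi / b) = 2 * Real.pi * b⁻¹ := by ring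
    rw [e]
    exact mul_lt_mul_of_pos_left this (by positivity)
  · positivity
  · intro z hz
    rw [div_eq_mul_inv, ← Dk_neg, norm_mul, mul_assoc]
    have k2 := hD (-β) z (by rw [Complex.neg_im, abs_neg, hβa]; linarith) (by simp)
    have e : (-β).im = (b + b⁻¹) / 2 + α.im := by rw [Complex.neg_im, hβi]; ring
    rw [e] at k2
    exact mul_le_mul (hFb z hz) k2 (norm_nonneg _) hC1
  · intro y
    exact ratio_per H h1 h2 y hβ

lemma abel {α : ℂ} (h1 : 0 < -α.im) (h2 : -α.im < (b + b⁻¹) / 2) :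
    ∃ C, ∀ δ : ℝ, 0 < δ → δ ≤ -α.im →
      ‖Fk b ε α (α + Complex.I * δ) - 1 / (2 * Real.pi * δ)‖ ≤ C := by
  have he := H.he
  have hpi := Real.pi_pos
  have hαa : |α.im| = -α.im := abs_of_neg (by linarith)
  obtain ⟨M, hM0, hM⟩ := Sk_bound H (by linarith : 0 < (b + b⁻¹) / 2 + α.im)
  obtain ⟨K, hK0, hK⟩ := Dk_bound H (by linarith : 0 < (b + b⁻¹) / 2 + α.im) (abs_nonneg α.re)
  set M' := 2 * M * Real.exp (2 * ε * |α.re|) with hM'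
  have hM'0 : 0 ≤ M' := by positivity
  let g : ℝ → ℝ := fun x => M' * Real.exp M' * Real.exp (-(2 * ε * |x|)) +
    K * Real.exp (-(2 * Real.pi * (-α.im) * |x|))
  have hg : Integrable g := ((integrable_exp_neg_abs (by positivity)).const_mul _).add
    ((integrable_exp_neg_abs (by positivity)).const_mul _)
  refine ⟨∫ x, g x, fun δ hδ hδ2 => ?_⟩
  have hyi : (α + Complex.I * δ).im = α.im + δ := by simp
  have hF : Integrable (Fint b ε α (α + Complex.I * δ)) := Fint_int H (by
    rw [hyi]; exact abs_lt.2 ⟨by linarith, by linarith⟩) h2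
  let e : ℝ → ℂ := fun x => ((Real.exp (-(2 * Real.pi * δ) * x) : ℝ) : ℂ)
  have hneg : -(2 * Real.pi * δ) < 0 := by
    have : 0 < 2 * Real.pi * δ := by positivity
    linarith
  have hei : IntegrableOn e (Ioi 0) := (integrableOn_exp_mul_Ioi hneg 0).ofReal
  have hev : ∫ x, (Ioi (0 : ℝ)).indicator e x = 1 / (2 * Real.pi * δ) := by
    rw [integral_indicator measurableSet_Ioi]
    simp only [e]
    rw [integral_complex_ofReal, integral_exp_mul_Ioi hneg]
    simp
  have hii : Integrable ((Ioi (0 : ℝ)).indicator e) := (integrable_indicator_iff measurableSet_Ioi).2 hei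
  unfold Fk
  rw [← hev, ← integral_sub hF hii]
  refine norm_integral_le_of_norm_le hg (Eventually.of_forall fun x => ?_)
  have hlt : |α.im| + |((x : ℝ) : ℂ).im| < (b + b⁻¹) / 2 := by simpa [hαa] using h2
  have hle : |α.im| + |((x : ℝ) : ℂ).im| ≤ (b + b⁻¹) / 2 - ((b + b⁻¹) / 2 + α.im) := by
    rw [hαa]; simp
  rcases le_or_gt x 0 with hx | hx
  · rw [indicator_of_notMem (by simpa using hx), sub_zero]
    have k := hK α x hle le_rfl
    unfold Fint
    rw [norm_mul, exp_norm, hyi]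
    rw [Complex.ofReal_re] at k
    have : Real.exp (-(2 * Real.pi * (x * (α.im + δ)))) ≤ 1 := by
      rw [Real.exp_le_one_iff]
      have : 0 ≤ x * (α.im + δ) := mul_nonneg_of_nonpos_of_nonpos hx (by linarith)
      have := mul_nonneg (by positivity : 0 ≤ 2 * Real.pi) this
      linarith
    refine (mul_le_mul this k (norm_nonneg _) zero_le_one).trans ?_
    simp only [g]
    have e1 : 2 * Real.pi * α.im * |x| = -(2 * Real.pi * (-α.im) * |x|) := by ring
    rw [one_mul, e1]
    have : 0 ≤ M' * Real.exp M' * Real.exp (-(2 * ε * |x|)) := by positivity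
    linarith
  · rw [indicator_of_mem (by simpa using hx)]
    set u := Sk b ε (-(x + α)) - Sk b ε (-(x - α)) with hu
    have hun : ‖u‖ ≤ M' * Real.exp (-(2 * ε * |x|)) := by
      have k : ∀ v : ℂ, |v.im| ≤ (b + b⁻¹) / 2 - ((b + b⁻¹) / 2 + α.im) → v.re ≤ |α.re| - x →
          ‖Sk b ε v‖ ≤ M * Real.exp (2 * ε * |α.re|) * Real.exp (-(2 * ε * |x|)) := by
        intro v v1 v2
        refine (hM v v1).trans ?_
        rw [mul_assoc M, ← Real.exp_add, abs_of_pos hx]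
        gcongr
        nlinarith
      have k1 := k (-(x + α)) (by rw [Complex.neg_im, abs_neg]; exact im_add_le hle) (by
        simp; linarith [neg_le_abs α.re])
      have k2 := k (-(x - α)) (by rw [Complex.neg_im, abs_neg]; exact im_sub_le hle) (by
        simp; linarith [le_abs_self α.re])
      refine (norm_sub_le _ _).trans ?_
      rw [hM']
      linarith
    have hun2 : ‖u‖ ≤ M' := hun.trans (by
      have : Real.exp (-(2 * ε * |x|)) ≤ 1 := by
        rw [Real.exp_le_one_iff]
        have : 0 ≤ 2 * ε * |x| := by positivity
        linarith
      nlinarith)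
    have hFe : Fint b ε α (α + Complex.I * δ) x = e x * Complex.exp u := by
      unfold Fint Dk
      rw [Dk_log_right H hlt, ← hu, Complex.exp_add, ← mul_assoc, ← Complex.exp_add]
      simp only [e]
      congr 1
      rw [Complex.ofReal_exp]
      congr 1
      push_cast
      linear_combination (2 * Real.pi * x * δ) * Complex.I_sq
    have hexp : ‖Complex.exp u - 1‖ ≤ ‖u‖ * Real.exp ‖u‖ := by
      simpa using Complex.norm_exp_sub_sum_le_norm_mul_exp u 1
    have hen : ‖e x‖ ≤ 1 := by
      simp only [e]
      rw [Complex.norm_real, Real.norm_eq_abs, Real.abs_exp, Real.exp_le_one_iff]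
      nlinarith
    have : Fint b ε α (α + Complex.I * δ) x - e x = e x * (Complex.exp u - 1) := by rw [hFe]; ring
    rw [this, norm_mul]
    have h3 : ‖u‖ * Real.exp ‖u‖ ≤ (M' * Real.exp (-(2 * ε * |x|))) * Real.exp M' := by
      gcongr
    have h4 : ‖e x‖ * ‖Complex.exp u - 1‖ ≤ 1 * (‖u‖ * Real.exp ‖u‖) :=
      mul_le_mul hen hexp (norm_nonneg _) zero_le_one
    simp only [g]
    have : 0 ≤ K * Real.exp (-(2 * Real.pi * (-α.im) * |x|)) := by positivity
    linarith

lemma abel_lim {α : ℂ} (h1 : 0 < -α.im) (h2 : -α.im < (b + b⁻¹) / 2) :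
    Tendsto (fun δ : ℝ => 2 * Real.pi * δ * Fk b ε α (α + Complex.I * δ)) (𝓝[>] 0) (𝓝 1) := by
  obtain ⟨C, hC⟩ := abel H h1 h2
  have hpi := Real.pi_pos
  rw [tendsto_iff_norm_sub_tendsto_zero]
  have t : Tendsto (fun δ : ℝ => 2 * Real.pi * δ * C) (𝓝[>] 0) (𝓝 0) := by
    have : Tendsto (fun δ : ℝ => 2 * Real.pi * δ * C) (𝓝 0) (𝓝 (2 * Real.pi * 0 * C)) :=
      Continuous.tendsto (by fun_prop) 0
    simp only [mul_zero, zero_mul] at this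
    exact this.mono_left nhdsWithin_le_nhds
  refine squeeze_zero' (Eventually.of_forall fun _ => norm_nonneg _) ?_ t
  filter_upwards [Ioc_mem_nhdsGT h1] with δ hδ
  have h0 : (0 : ℝ) < 2 * Real.pi * δ := mul_pos (by positivity) hδ.1
  have hc : (2 * Real.pi * δ : ℂ) ≠ 0 := by exact_mod_cast h0.ne'
  have e : 2 * Real.pi * δ * Fk b ε α (α + Complex.I * δ) - 1 =
      2 * Real.pi * δ * (Fk b ε α (α + Complex.I * δ) - 1 / (2 * Real.pi * δ)) := by
    rw [mul_sub, mul_one_div_cancel hc]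
  have hn : ‖(2 * Real.pi * δ : ℂ)‖ = 2 * Real.pi * δ := by
    have : (2 * Real.pi * δ : ℂ) = ((2 * Real.pi * δ : ℝ) : ℂ) := by push_cast; ring
    rw [this, Complex.norm_real, Real.norm_eq_abs, abs_of_pos h0]
  rw [e, norm_mul, hn]
  exact mul_le_mul_of_nonneg_left (hC δ hδ.1 hδ.2) h0.le

end
end QD

open MeasureTheory

namespace QD
open Filter Topology Set

section
variable {b ε : ℝ} (H : Hyp b ε)
include H

lemma arg_im {α : ℂ} (h1 : 0 < -α.im) (h2 : -α.im < (b + b⁻¹) / 2) :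
    |(2 * α + Complex.I * (((b + b⁻¹) / 2 : ℝ) : ℂ)).im| < (b + b⁻¹) / 2 := by
  have : (2 * α + Complex.I * (((b + b⁻¹) / 2 : ℝ) : ℂ)).im = 2 * α.im + (b + b⁻¹) / 2 := by
    rw [Complex.add_im, Complex.I_mul_im, Complex.ofReal_re]
    simp
  rw [this]
  exact abs_lt.2 ⟨by linarith, by linarith⟩

lemma key_lim {α : ℂ} (h1 : b / 2 < -α.im) (h2 : -α.im < (b + b⁻¹) / 2) {β : ℂ}
    (hβ : β = -(Complex.I * (((b + b⁻¹) / 2 : ℝ) : ℂ)) - α) :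
    Tendsto (fun δ : ℝ => Fk b ε α 0 / Dk b ε β 0 * (2 * Real.pi * δ *
      Complex.exp (Ek b ε (-(Complex.I * (((b + b⁻¹) / 2 : ℝ) : ℂ)) + Complex.I * δ))))
      (𝓝[>] 0) (𝓝 (Complex.exp (Ek b ε (2 * α + Complex.I * (((b + b⁻¹) / 2 : ℝ) : ℂ))))) := by
  have hb := H.hb
  have h0 : 0 < -α.im := by linarith
  have l1 := abel_lim H h0 h2
  have l2 : Tendsto (fun δ : ℝ => Complex.exp (Ek b ε (2 * α + Complex.I * (((b + b⁻¹) / 2 : ℝ) : ℂ)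
      + Complex.I * δ))) (𝓝[>] 0) (𝓝 (Complex.exp (Ek b ε (2 * α + Complex.I * (((b + b⁻¹) / 2 : ℝ) : ℂ))))) := by
    refine (Complex.continuous_exp.tendsto _).comp ?_
    refine ((Ek_diff H (arg_im H h0 h2)).continuousAt.tendsto).comp ?_
    have : Tendsto (fun δ : ℝ => 2 * α + Complex.I * (((b + b⁻¹) / 2 : ℝ) : ℂ) + Complex.I * (δ : ℂ)) (𝓝 0)
      (𝓝 (2 * α + Complex.I * (((b + b⁻¹) / 2 : ℝ) : ℂ) + Complex.I * ((0 : ℝ) : ℂ))) :=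
      Continuous.tendsto (by fun_prop) 0
    rw [Complex.ofReal_zero, mul_zero, add_zero] at this
    exact this.mono_left nhdsWithin_le_nhds
  have l3 := l1.mul l2
  rw [one_mul] at l3
  refine l3.congr' ?_
  filter_upwards [Ioc_mem_nhdsGT h0] with δ hδ
  have hyi : (α + Complex.I * δ).im = α.im + δ := by simp
  rw [ratio_const H h1 h2 hβ (y := α + Complex.I * δ) (by
    rw [hyi]; exact abs_lt.2 ⟨by linarith [hδ.1], by linarith [hδ.2]⟩)]
  have e : Dk b ε β (α + Complex.I * δ) =
      Complex.exp (Ek b ε (-(Complex.I * (((b + b⁻¹) / 2 : ℝ) : ℂ)) + Complex.I * δ)) /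
      Complex.exp (Ek b ε (2 * α + Complex.I * (((b + b⁻¹) / 2 : ℝ) : ℂ) + Complex.I * δ)) := by
    unfold Dk
    rw [← Complex.exp_sub]
    congr 3
    · rw [hβ]; ring
    · rw [hβ]; ring
  rw [e]
  have := Complex.exp_ne_zero (Ek b ε (2 * α + Complex.I * (((b + b⁻¹) / 2 : ℝ) : ℂ) + Complex.I * δ))
  rw [mul_assoc, mul_assoc (Fk b ε α 0 / Dk b ε β 0), div_mul_cancel₀ _ this]
  ring

lemma exists_kappa : ∃ κ : ℂ, ∀ α : ℂ, b / 2 < -α.im → -α.im < (b + b⁻¹) / 2 → ∀ y : ℝ,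
    Fk b ε α y = κ * Complex.exp (Ek b ε (2 * α + Complex.I * (((b + b⁻¹) / 2 : ℝ) : ℂ))) *
      Dk b ε (-(Complex.I * (((b + b⁻¹) / 2 : ℝ) : ℂ)) - α) y := by
  have hb := H.hb
  have hbi := inv_pos.2 hb
  let α0 : ℂ := Complex.I * ((-(b / 2 + b⁻¹ / 4) : ℝ) : ℂ)
  have hα0 : α0.im = -(b / 2 + b⁻¹ / 4) := by
    simp only [α0]; rw [Complex.I_mul_im, Complex.ofReal_re]
  have l0 := key_lim H (α := α0) (by rw [hα0]; linarith) (by rw [hα0]; linarith) rfl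
  set R0 := Fk b ε α0 0 / Dk b ε (-(Complex.I * (((b + b⁻¹) / 2 : ℝ) : ℂ)) - α0) 0
  set w0 := Complex.exp (Ek b ε (2 * α0 + Complex.I * (((b + b⁻¹) / 2 : ℝ) : ℂ))) with hw0
  have hw : w0 ≠ 0 := Complex.exp_ne_zero _
  have hR : R0 ≠ 0 := by
    intro h
    rw [h] at l0
    simp only [zero_mul] at l0
    exact hw (tendsto_nhds_unique l0 tendsto_const_nhds)
  refine ⟨R0 / w0, fun α h1 h2 y => ?_⟩
  have l := key_lim H h1 h2 rfl
  have l' := (l0.const_mul (Fk b ε α 0 / Dk b ε (-(Complex.I * (((b + b⁻¹) / 2 : ℝ) : ℂ)) - α) 0))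
  have l'' := l.const_mul R0
  have e := tendsto_nhds_unique (l'.congr fun δ => by ring) l''
  rw [ratio_const H h1 h2 rfl (y := (y : ℂ)) (by simp; linarith)]
  congr 1
  rw [eq_comm, div_mul_eq_mul_div, div_eq_iff hw, ← e]

lemma all_alpha : ∃ κ : ℂ, ∀ α : ℂ, 0 < -α.im → -α.im < (b + b⁻¹) / 2 → ∀ y : ℝ,
    Fk b ε α y = κ * Complex.exp (Ek b ε (2 * α + Complex.I * (((b + b⁻¹) / 2 : ℝ) : ℂ))) *
      Dk b ε (-(Complex.I * (((b + b⁻¹) / 2 : ℝ) : ℂ)) - α) y := by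
  obtain ⟨κ, hκ⟩ := exists_kappa H
  have hb := H.hb
  have hbi := inv_pos.2 hb
  refine ⟨κ, fun α h1 h2 y => ?_⟩
  let U : Set ℂ := {α | α.im ∈ Ioo (-((b + b⁻¹) / 2)) 0}
  have hU : IsOpen U := isOpen_Ioo.preimage Complex.continuous_im
  have hUc : IsPreconnected U :=
    ((convex_Ioo (-((b + b⁻¹) / 2)) 0).is_linear_preimage Complex.imLm.isLinear).isPreconnected
  have d1 : DifferentiableOn ℂ (fun α => Fk b ε α y) U := fun α hα =>
    (Fk_diff' H (by simp; linarith [hα.2]) (by linarith [hα.1])).differentiableWithinAt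
  have d2 : DifferentiableOn ℂ (fun α => κ * Complex.exp (Ek b ε (2 * α + Complex.I * (((b + b⁻¹) / 2 : ℝ) : ℂ))) *
      Dk b ε (-(Complex.I * (((b + b⁻¹) / 2 : ℝ) : ℂ)) - α) y) U := by
    intro α hα
    refine DifferentiableAt.differentiableWithinAt ?_
    have h1 : 0 < -α.im := by linarith [hα.2]
    have h2 : -α.im < (b + b⁻¹) / 2 := by linarith [hα.1]
    have e1 : DifferentiableAt ℂ (fun α => Ek b ε (2 * α + Complex.I * (((b + b⁻¹) / 2 : ℝ) : ℂ))) α :=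
      DifferentiableAt.comp (f := fun α => 2 * α + Complex.I * (((b + b⁻¹) / 2 : ℝ) : ℂ)) α
        (Ek_diff H (arg_im H h1 h2)) (by fun_prop)
    have e2 : DifferentiableAt ℂ (fun α => Dk b ε (-(Complex.I * (((b + b⁻¹) / 2 : ℝ) : ℂ)) - α) y) α := by
      refine DifferentiableAt.comp (f := fun α => -(Complex.I * (((b + b⁻¹) / 2 : ℝ) : ℂ)) - α)
        (g := fun β => Dk b ε β y) α (Dk_diff' H ?_) (by fun_prop)
      rw [Complex.ofReal_im, abs_zero, add_zero, Complex.sub_im, Complex.neg_im, Complex.I_mul_im, Complex.ofReal_re]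
      exact abs_lt.2 ⟨by linarith, by linarith⟩
    exact (e1.cexp.const_mul κ).mul e2
  let α0 : ℂ := Complex.I * ((-(b / 2 + b⁻¹ / 4) : ℝ) : ℂ)
  have hα0 : α0.im = -(b / 2 + b⁻¹ / 4) := by
    simp only [α0]; rw [Complex.I_mul_im, Complex.ofReal_re]
  have m0 : α0 ∈ U := by
    show α0.im ∈ Ioo (-((b + b⁻¹) / 2)) 0
    rw [hα0]; exact ⟨by linarith, by linarith⟩
  refine AnalyticOnNhd.eqOn_of_preconnected_of_eventuallyEq (d1.analyticOnNhd hU) (d2.analyticOnNhd hU) hUc m0 ?_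
    (show α.im ∈ Ioo (-((b + b⁻¹) / 2)) 0 from ⟨by linarith, by linarith⟩)
  have : {α : ℂ | α.im ∈ Ioo (-((b + b⁻¹) / 2)) (-(b / 2))} ∈ 𝓝 α0 := by
    refine (isOpen_Ioo.preimage Complex.continuous_im).mem_nhds ?_
    rw [mem_preimage, hα0]; exact ⟨by linarith, by linarith⟩
  filter_upwards [this] with z hz
  exact hκ z (by linarith [hz.2]) (by linarith [hz.1]) y

end
end QD

open MeasureTheory

namespace QD
open Filter Topology Set
open scoped ComplexConjugate FourierTransform

section
variable {b ε : ℝ} (H : Hyp b ε)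
include H

lemma kappa_one {κ : ℂ} (hκ : ∀ α : ℂ, 0 < -α.im → -α.im < (b + b⁻¹) / 2 → ∀ y : ℝ,
    Fk b ε α y = κ * Complex.exp (Ek b ε (2 * α + Complex.I * (((b + b⁻¹) / 2 : ℝ) : ℂ))) *
      Dk b ε (-(Complex.I * (((b + b⁻¹) / 2 : ℝ) : ℂ)) - α) y) : κ = 1 := by
  have hb := H.hb
  have hbi := inv_pos.2 hb
  obtain ⟨α, hα⟩ : ∃ α : ℂ, α = -(Complex.I * (((b + b⁻¹) / 4 : ℝ) : ℂ)) := ⟨_, rfl⟩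
  have hαi : α.im = -((b + b⁻¹) / 4) := by
    rw [hα, Complex.neg_im, Complex.I_mul_im, Complex.ofReal_re]
  have h1 : 0 < -α.im := by rw [hαi]; linarith
  have h2 : -α.im < (b + b⁻¹) / 2 := by rw [hαi]; linarith
  have hαa : |α.im| < (b + b⁻¹) / 2 := by rw [abs_of_neg (by linarith)]; exact h2
  have E0 : Ek b ε 0 = 0 := by
    have := Ek_neg H (z := 0) (by simp; positivity)
    rw [neg_zero] at this
    linear_combination this / 2
  have hF : ∀ y : ℝ, Fk b ε α y = κ * Dk b ε α y := by
    intro y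
    rw [hκ α h1 h2 y]
    have e1 : 2 * α + Complex.I * (((b + b⁻¹) / 2 : ℝ) : ℂ) = 0 := by rw [hα]; push_cast; ring
    have e2 : -(Complex.I * (((b + b⁻¹) / 2 : ℝ) : ℂ)) - α = α := by rw [hα]; push_cast; ring
    rw [e1, e2, E0, Complex.exp_zero, mul_one]
  let f : ℝ → ℂ := fun x => Dk b ε α x
  have hfc : Continuous f := Dk_cont H hαa
  have hfi : Integrable f := by
    have := Fint_int H (y := 0) (by simpa using h1) h2
    refine this.congr (Eventually.of_forall fun x => ?_)
    simp [Fint, f]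
  have hinv : ∀ y, 𝓕⁻ f y = κ * f y := by
    intro y
    rw [Real.fourierInv_eq', ← hF y]
    unfold Fk
    congr 1
    ext x
    unfold Fint
    simp only [smul_eq_mul, f]
    congr 2
    simp
    ring
  have hfou : 𝓕 f = fun y => κ * f y := by
    ext y
    have := Real.fourierInv_eq_fourier_neg f (-y)
    rw [neg_neg] at this
    rw [← this, hinv]
    congr 1
    simp only [f]
    rw [Complex.ofReal_neg]
    exact Dk_even H (by simpa using hαa)
  have hfou' : Integrable (𝓕 f) := by rw [hfou]; exact hfi.const_mul κ
  have k1 := congrFun (hfc.fourierInv_fourier_eq hfi hfou') 0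
  have k2 : 𝓕⁻ (𝓕 f) 0 = κ * 𝓕⁻ f 0 := by
    rw [hfou, Real.fourierInv_eq', Real.fourierInv_eq', ← integral_const_mul]
    congr 1
    ext x
    simp only [smul_eq_mul]
    ring
  rw [k2, hinv] at k1
  have hf0 : f 0 ≠ 0 := Dk_ne _ _ _ _
  have hsq : κ * κ = 1 := by
    apply mul_right_cancel₀ hf0
    rw [one_mul, mul_assoc]; exact k1
  have hpos : ∀ x : ℝ, f x = ((Real.exp (2 * (Ek b ε (x + α)).re) : ℝ) : ℂ) := by
    intro x
    have c := Ek_conj b ε (x + α)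
    have e : conj ((x : ℂ) + α) = x - α := by
      rw [hα, map_add, map_neg, map_mul, Complex.conj_I, Complex.conj_ofReal, Complex.conj_ofReal]
      ring
    rw [e] at c
    simp only [f]
    unfold Dk
    rw [Complex.ofReal_exp]
    congr 1
    rw [sub_eq_add_neg, ← c, Complex.add_conj]
  have k3 := hF 0
  have k4 : Fk b ε α ((0 : ℝ) : ℂ) = ((∫ x : ℝ, Real.exp (2 * (Ek b ε (x + α)).re) : ℝ) : ℂ) := by
    rw [← integral_complex_ofReal]
    unfold Fk
    congr 1
    ext x
    rw [← hpos]
    simp [Fint, f]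
  have k5 : (0 : ℝ) ≤ ∫ x : ℝ, Real.exp (2 * (Ek b ε (x + α)).re) :=
    integral_nonneg fun x => (Real.exp_pos _).le
  rcases mul_self_eq_one_iff.1 hsq with h | h
  · exact h
  · exfalso
    have k6 : Dk b ε α ((0 : ℝ) : ℂ) = _ := hpos 0
    rw [k4, k6, h, neg_one_mul, ← Complex.ofReal_neg] at k3
    have := Complex.ofReal_injective k3
    have := Real.exp_pos (2 * (Ek b ε (((0 : ℝ) : ℂ) + α)).re)
    linarith

end

lemma wb_eq (b ε : ℝ) (z : ℂ) : wb b ε z = Complex.exp (Ek b ε z) := by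
  unfold wb Ek Sk kS
  simp only [mul_one_div]

end QD

theorem Dfun_fourier_transform (b ε : ℝ) (hb : 0 < b) (hε0 : 0 < ε)
    (hε : ε < Real.pi * min b b⁻¹) (α : ℂ)
    (hα1 : -((b + b⁻¹) / 2) < α.im) (hα2 : α.im < 0) (y : ℝ) :
    Integrable (fun x : ℝ =>
        Complex.exp (2 * ((Real.pi : ℝ) : ℂ) * Complex.I * (x : ℂ) * (y : ℂ)) *
          Dfun b ε α (x : ℂ)) ∧
      ∫ x : ℝ,
          Complex.exp (2 * ((Real.pi : ℝ) : ℂ) * Complex.I * (x : ℂ) * (y : ℂ)) *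
            Dfun b ε α (x : ℂ) =
        wb b ε (2 * α + Complex.I * (((b + b⁻¹) / 2 : ℝ) : ℂ)) *
          Dfun b ε (-(Complex.I * (((b + b⁻¹) / 2 : ℝ) : ℂ)) - α) (y : ℂ) := by
  have hpi := Real.pi_pos
  have hbi := inv_pos.2 hb
  have H : QD.Hyp b ε := by
    have a1 : ε < Real.pi * b :=
      hε.trans_le (mul_le_mul_of_nonneg_left (min_le_left _ _) hpi.le)
    have a2 : ε < Real.pi * b⁻¹ :=
      hε.trans_le (mul_le_mul_of_nonneg_left (min_le_right _ _) hpi.le)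
    refine ⟨hb, hε0, ?_, ?_⟩
    · have := mul_lt_mul_of_pos_left a2 hb
      rwa [mul_left_comm, mul_inv_cancel₀ hb.ne', mul_one] at this
    · have := mul_lt_mul_of_pos_left a1 hbi
      rwa [mul_left_comm, inv_mul_cancel₀ hb.ne', mul_one] at this
  have h1 : 0 < -α.im := by linarith
  have h2 : -α.im < (b + b⁻¹) / 2 := by linarith
  have e : (fun x : ℝ =>
        Complex.exp (2 * ((Real.pi : ℝ) : ℂ) * Complex.I * (x : ℂ) * (y : ℂ)) *
          Dfun b ε α (x : ℂ)) = QD.Fint b ε α y := by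
    ext x
    rw [QD.Dfun_eq H (by rw [Complex.ofReal_im, abs_zero, add_zero, abs_of_neg hα2]; exact h2)]
    rfl
  rw [e]
  refine ⟨QD.Fint_int H (by simpa using h1) h2, ?_⟩
  obtain ⟨κ, hκ⟩ := QD.all_alpha H
  have hk := QD.kappa_one H hκ
  have h := hκ α h1 h2 y
  rw [hk, one_mul] at h
  rw [QD.wb_eq, QD.Dfun_eq H]
  · exact h
  · rw [Complex.ofReal_im, abs_zero, add_zero, Complex.sub_im, Complex.neg_im, Complex.I_mul_im, Complex.ofReal_re]
    exact abs_lt.2 ⟨by linarith, by linarith⟩
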